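/- arXiv:2108.08410 — 10 statements merged into one kernel-verified Lean document; each statement's English description precedes it below -/
import Mathlib

section
/- For all k_1, k_2 ∈ ℕ (k_1, k_2 ≥ 1), the two-color Ramsey number satisfies R_2(k_1,k_2) ≤ binom(k_1+k_2−2, k_1−1). -/
/-- A coloring `C` of the edges of the complete graph on `Fin N` has a monochromatic
clique of size `m` in color `i`. -/
def MonochromaticClique {N r : ℕ} (C : Sym2 (Fin N) → Fin r) (i : Fin r) (m : ℕ) : Prop :=
  ∃ S : Finset (Fin N), S.card = m ∧ ∀ x ∈ S, ∀ y ∈ S, x ≠ y → C s(x, y) = i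

/-- `N` vertices suffice: every `r`-coloring of the edges of the complete graph on `N`
vertices yields, for some color `i`, a monochromatic clique on `k i` vertices in color `i`. -/
def RamseyProp (N r : ℕ) (k : Fin r → ℕ) : Prop :=
  ∀ C : Sym2 (Fin N) → Fin r, ∃ i : Fin r, MonochromaticClique C i (k i)

/-- The Ramsey number `R_r(k_1, …, k_r)`: the least `N` such that every `r`-coloring of the
edges of the complete graph on `N` vertices yields a monochromatic clique on `k i` vertices
in some color `i`. -/
noncomputable def ramseyNumber (r : ℕ) (k : Fin r → ℕ) : ℕ :=
  sInf {N | RamseyProp N r k}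

section ErdosSzekeres

variable {V : Type*} [DecidableEq V]

theorem exists_insert_monochromatic {r : ℕ} {C : Sym2 V → Fin r} {A S : Finset V} {v : V}
    {i : Fin r} {m : ℕ} (hv : v ∈ A) (hSA : S ⊆ {x ∈ A.erase v | C s(v, x) = i})
    (hcard : S.card = m) (hS : ∀ x ∈ S, ∀ y ∈ S, x ≠ y → C s(x, y) = i) :
    ∃ T ⊆ A, T.card = m + 1 ∧ ∀ x ∈ T, ∀ y ∈ T, x ≠ y → C s(x, y) = i := by
  have h : ∀ x ∈ S, (x ≠ v ∧ x ∈ A) ∧ C s(v, x) = i := fun x hx => by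
    simpa using hSA hx
  refine ⟨insert v S, ?_, ?_, ?_⟩
  · exact Finset.insert_subset hv fun x hx => (h x hx).1.2
  · rw [Finset.card_insert_of_notMem fun hx => (h v hx).1.1 rfl, hcard]
  · intro x hx y hy hxy
    rcases Finset.mem_insert.1 hx with rfl | hxS <;> rcases Finset.mem_insert.1 hy with rfl | hyS
    · exact absurd rfl hxy
    · exact (h y hyS).2
    · rw [Sym2.eq_swap]
      exact (h x hxS).2
    · exact hS x hxS y hyS hxy

theorem exists_monochromatic_of_choose_le_card (C : Sym2 V → Fin 2) (a b : ℕ) (A : Finset V)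
    (hA : (a + b).choose a ≤ A.card) :
    (∃ S ⊆ A, S.card = a + 1 ∧ ∀ x ∈ S, ∀ y ∈ S, x ≠ y → C s(x, y) = 0) ∨
      ∃ S ⊆ A, S.card = b + 1 ∧ ∀ x ∈ S, ∀ y ∈ S, x ≠ y → C s(x, y) = 1 := by
  have hpos : 0 < A.card := (Nat.choose_pos (Nat.le_add_right a b)).trans_le hA
  obtain ⟨v, hv⟩ := Finset.card_pos.1 hpos
  induction a generalizing b A v with
  | zero => exact .inl ⟨{v}, by simpa using hv, by simp, by simp⟩
  | succ a iha =>
    induction b generalizing A v with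
    | zero => exact .inr ⟨{v}, by simpa using hv, by simp, by simp⟩
    | succ b ihb =>
      have hsplit : ({x ∈ A.erase v | C s(v, x) = 0}).card +
          ({x ∈ A.erase v | C s(v, x) = 1}).card + 1 = A.card := by
        have hne : ∀ c : Fin 2, c = 1 ↔ ¬ c = 0 := by decide
        simp only [hne (C _)]
        rw [Finset.card_filter_add_card_filter_not, Finset.card_erase_add_one hv]
      have hchoose : (a + 1 + (b + 1)).choose (a + 1) =
          (a + (b + 1)).choose a + (a + 1 + b).choose (a + 1) := by
        rw [show a + 1 + (b + 1) = (a + (b + 1)) + 1 by ring, Nat.choose_succ_succ,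
          show a + 1 + b = a + (b + 1) by ring]
      by_cases h0 : (a + (b + 1)).choose a ≤ ({x ∈ A.erase v | C s(v, x) = 0}).card
      · have hp := (Nat.choose_pos (Nat.le_add_right a (b + 1))).trans_le h0
        obtain ⟨w, hw⟩ := Finset.card_pos.1 hp
        rcases iha (b + 1) _ h0 hp w hw with ⟨S, hSA, hc, hS⟩ | ⟨S, hSA, hS⟩
        · exact .inl (exists_insert_monochromatic hv hSA hc hS)
        · exact .inr ⟨S, hSA.trans ((Finset.filter_subset _ _).trans (A.erase_subset v)), hS⟩
      · have h1 : (a + 1 + b).choose (a + 1) ≤ ({x ∈ A.erase v | C s(v, x) = 1}).card := by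
          omega
        have hp := (Nat.choose_pos (Nat.le_add_right (a + 1) b)).trans_le h1
        obtain ⟨w, hw⟩ := Finset.card_pos.1 hp
        rcases ihb _ h1 hp w hw with ⟨S, hSA, hS⟩ | ⟨S, hSA, hc, hS⟩
        · exact .inl ⟨S, hSA.trans ((Finset.filter_subset _ _).trans (A.erase_subset v)), hS⟩
        · exact .inr (exists_insert_monochromatic hv hSA hc hS)

end ErdosSzekeres

theorem stmt_1 (k₁ k₂ : ℕ) (h₁ : 1 ≤ k₁) (h₂ : 1 ≤ k₂) :
    ramseyNumber 2 ![k₁, k₂] ≤ Nat.choose (k₁ + k₂ - 2) (k₁ - 1) := by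
  obtain ⟨a, rfl⟩ := Nat.exists_eq_add_of_le' h₁
  obtain ⟨b, rfl⟩ := Nat.exists_eq_add_of_le' h₂
  rw [show a + 1 + (b + 1) - 2 = a + b by omega, Nat.add_sub_cancel]
  refine Nat.sInf_le fun C => ?_
  rcases exists_monochromatic_of_choose_le_card C a b Finset.univ (by simp) with
    ⟨S, -, hS⟩ | ⟨S, -, hS⟩
  · exact ⟨0, S, hS⟩
  · exact ⟨1, S, hS⟩
end

section
/- For integers r ≥ 2 and k_1, …, k_r ≥ 2, the Ramsey number satisfies R_r(k_1,…,k_r) ≤ multinomial(k_1+⋯+k_r−r; k_1−1, k_2−1, …, k_r−1) = (k_1+⋯+k_r−r)! / ((k_1−1)!·(k_2−1)!⋯(k_r−1)!). -/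
theorem Finset.sum_update_sub_one {ι : Type*} [Fintype ι] [DecidableEq ι] (a : ι → ℕ) {i : ι}
    (hi : 0 < a i) : ∑ j, Function.update a i (a i - 1) j = ∑ j, a j - 1 := by
  rw [Finset.sum_update_of_mem (Finset.mem_univ i), ← Finset.erase_eq,
    ← Finset.add_sum_erase _ a (Finset.mem_univ i)]
  omega

/-- Pascal's rule for multinomial coefficients with positive entries. -/
theorem Nat.multinomial_eq_sum_update {ι : Type*} [Fintype ι] [DecidableEq ι] [Nonempty ι]
    (a : ι → ℕ) (ha : ∀ i, 0 < a i) :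
    Nat.multinomial Finset.univ a =
      ∑ i, Nat.multinomial Finset.univ (Function.update a i (a i - 1)) := by
  have hpos : 0 < ∏ i, (a i).factorial := Finset.prod_pos fun i _ => Nat.factorial_pos _
  have hsum : 0 < ∑ i, a i := Finset.sum_pos (fun i _ => ha i) Finset.univ_nonempty
  have key (i : ι) : (∏ j, (a j).factorial) *
      Nat.multinomial Finset.univ (Function.update a i (a i - 1)) =
        a i * (∑ j, a j - 1).factorial := by
    have hp : ∏ j, (a j).factorial =
        a i * ∏ j, (Function.update a i (a i - 1) j).factorial := by
      rw [← Finset.mul_prod_erase _ _ (Finset.mem_univ i),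
        ← Finset.mul_prod_erase Finset.univ
          (fun j => (Function.update a i (a i - 1) j).factorial) (Finset.mem_univ i),
        Function.update_self, ← mul_assoc, Nat.mul_factorial_pred (ha i).ne']
      congr 1
      refine Finset.prod_congr rfl fun j hj => ?_
      rw [Function.update_of_ne (Finset.ne_of_mem_erase hj)]
    rw [hp, mul_assoc, Nat.multinomial_spec, Finset.sum_update_sub_one a (ha i)]
  refine Nat.eq_of_mul_eq_mul_left hpos ?_
  rw [Nat.multinomial_spec, Finset.mul_sum, Finset.sum_congr rfl fun i _ => key i,
    ← Finset.sum_mul, Nat.mul_factorial_pred hsum.ne']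

/-- A vertex set of size at least the multinomial coefficient of `a` contains, for some color `i`,
a monochromatic clique of size `a i + 1` in color `i`. -/
theorem exists_monochromatic_subset_of_multinomial_le_card {V ι : Type*} [DecidableEq V]
    [Fintype ι] [DecidableEq ι] [Nontrivial ι] (C : Sym2 V → ι) (a : ι → ℕ) (A : Finset V)
    (hA : Nat.multinomial Finset.univ a ≤ A.card) :
    ∃ i, ∃ S ⊆ A, S.card = a i + 1 ∧ ∀ x ∈ S, ∀ y ∈ S, x ≠ y → C s(x, y) = i := by
  induction hn : ∑ i, a i generalizing a A with
  | zero =>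
    obtain ⟨v, hv⟩ := Finset.card_pos.mp ((Nat.multinomial_pos Finset.univ a).trans_le hA)
    obtain ⟨i⟩ := (inferInstance : Nonempty ι)
    have hi : a i = 0 := Finset.sum_eq_zero_iff.mp hn i (Finset.mem_univ i)
    exact ⟨i, {v}, by simpa using hv, by simp [hi], by simp⟩
  | succ n ih =>
    obtain ⟨v, hv⟩ := Finset.card_pos.mp ((Nat.multinomial_pos Finset.univ a).trans_le hA)
    by_cases h0 : ∃ i, a i = 0
    · obtain ⟨i, hi⟩ := h0
      exact ⟨i, {v}, by simpa using hv, by simp [hi], by simp⟩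
    replace h0 : ∀ i, 0 < a i := fun i => Nat.pos_of_ne_zero fun h => h0 ⟨i, h⟩
    let N (i : ι) : Finset V := {w ∈ A.erase v | C s(v, w) = i}
    obtain ⟨i, hi⟩ : ∃ i, Nat.multinomial Finset.univ (Function.update a i (a i - 1)) ≤
        (N i).card := by
      by_contra! hlt
      have hcard : (A.erase v).card = ∑ i, (N i).card :=
        Finset.card_eq_sum_card_fiberwise fun _ _ => Finset.mem_coe.mpr (Finset.mem_univ _)
      have hle : ∑ i, ((N i).card + 1) ≤
          ∑ i, Nat.multinomial Finset.univ (Function.update a i (a i - 1)) :=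
        Finset.sum_le_sum fun i _ => hlt i
      rw [← Nat.multinomial_eq_sum_update a h0, Finset.sum_add_distrib, ← hcard] at hle
      have hι : 1 < Fintype.card ι := Fintype.one_lt_card
      have := Finset.card_erase_add_one hv
      simp only [Finset.sum_const, Finset.card_univ, smul_eq_mul, mul_one] at hle
      omega
    have hs : ∑ j, Function.update a i (a i - 1) j = n := by
      rw [Finset.sum_update_sub_one a (h0 i), hn, Nat.add_sub_cancel]
    obtain ⟨j, S, hSN, hScard, hS⟩ := ih _ _ hi hs
    have hN : ∀ w ∈ S, w ≠ v ∧ w ∈ A ∧ C s(v, w) = i := fun w hw => by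
      simpa [N, and_assoc] using hSN hw
    by_cases hji : j = i
    · subst hji
      refine ⟨j, insert v S, ?_, ?_, ?_⟩
      · exact Finset.insert_subset hv fun w hw => (hN w hw).2.1
      · rw [Finset.card_insert_of_notMem fun h => (hN v h).1 rfl, hScard, Function.update_self,
          Nat.sub_add_cancel (h0 j)]
      · intro x hx y hy hxy
        rcases Finset.mem_insert.mp hx with hxv | hxS <;>
          rcases Finset.mem_insert.mp hy with hyv | hyS
        · exact absurd (hxv.trans hyv.symm) hxy
        · rw [hxv]
          exact (hN y hyS).2.2
        · rw [hyv, Sym2.eq_swap]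
          exact (hN x hxS).2.2
        · exact hS x hxS y hyS hxy
    · rw [Function.update_of_ne hji] at hScard
      exact ⟨j, S, fun w hw => (hN w hw).2.1, hScard, hS⟩

theorem stmt_3 (r : ℕ) (hr : 2 ≤ r) (k : Fin r → ℕ) (hk : ∀ i, 2 ≤ k i) :
    ramseyNumber r k ≤ Nat.multinomial Finset.univ (fun i => k i - 1) ∧
    (Nat.multinomial Finset.univ (fun i => k i - 1) : ℝ) =
      (((∑ i : Fin r, k i) - r).factorial : ℝ) / ∏ i : Fin r, ((k i - 1).factorial : ℝ) := by
  constructor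
  · refine Nat.sInf_le fun C => ?_
    have : Nontrivial (Fin r) := Fin.nontrivial_iff_two_le.mpr hr
    obtain ⟨i, S, -, hcard, hS⟩ := exists_monochromatic_subset_of_multinomial_le_card C
      (fun i => k i - 1) Finset.univ (by simp)
    have := hk i
    exact ⟨i, S, by omega, hS⟩
  · have hsum : ∑ i, (k i - 1) = (∑ i, k i) - r := by
      rw [Finset.sum_tsub_distrib _ fun i _ => one_le_two.trans (hk i)]
      simp
    rw [eq_div_iff (Finset.prod_ne_zero_iff.mpr fun i _ => by positivity), ← hsum, mul_comm]
    exact_mod_cast Nat.multinomial_spec Finset.univ fun i => k i - 1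
end

section
/- For integers r ≥ 2 and k_1, …, k_r ≥ 2, the Ramsey number satisfies R_r(k_1,…,k_r) ≤ multinomial(k_1+⋯+k_r−2r+2; k_1−1, k_2−1, k_3−2, k_4−2, …, k_r−2) = (k_1+⋯+k_r−2r+2)! / ((k_1−1)!·(k_2−1)!·(k_3−2)!⋯(k_r−2)!). -/
/-- Lowering one positive entry of a multinomial coefficient. -/
theorem Nat.sum_mul_multinomial_update_pred {ι : Type*} [Fintype ι] [DecidableEq ι]
    (a : ι → ℕ) {i : ι} (hi : a i ≠ 0) :
    (∑ j, a j) * Nat.multinomial Finset.univ (Function.update a i (a i - 1)) =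
      a i * Nat.multinomial Finset.univ a := by
  set a' := Function.update a i (a i - 1) with ha'
  have hsum : ∑ j, a j = (∑ j, a' j) + 1 := by
    rw [ha', Finset.sum_update_of_mem (Finset.mem_univ i),
      ← Finset.add_sum_erase _ a (Finset.mem_univ i), Finset.sdiff_singleton_eq_erase]
    omega
  have hprod : ∏ j, (a j).factorial = a i * ∏ j, (a' j).factorial := by
    rw [← Finset.mul_prod_erase _ _ (Finset.mem_univ i),
      ← Finset.mul_prod_erase _ (fun j => (a' j).factorial) (Finset.mem_univ i), ← mul_assoc]
    congr 1
    · simp [ha', Nat.mul_factorial_pred hi]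
    · refine Finset.prod_congr rfl fun j hj => ?_
      rw [ha', Function.update_of_ne (Finset.ne_of_mem_erase hj)]
  refine Nat.eq_of_mul_eq_mul_left
    (Finset.prod_pos fun j _ => Nat.factorial_pos (a' j) : 0 < ∏ j, (a' j).factorial) ?_
  calc (∏ j, (a' j).factorial) * ((∑ j, a j) * Nat.multinomial Finset.univ a')
      = (∑ j, a j) * ((∏ j, (a' j).factorial) * Nat.multinomial Finset.univ a') := by ring
    _ = (∑ j, a j).factorial := by
        rw [Nat.multinomial_spec, hsum, Nat.factorial_succ]
    _ = (∏ j, (a j).factorial) * Nat.multinomial Finset.univ a := (Nat.multinomial_spec _ _).symm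
    _ = _ := by rw [hprod]; ring

/-- Pascal's rule for multinomial coefficients. -/
theorem Nat.sum_multinomial_update_pred {ι : Type*} [Fintype ι] [DecidableEq ι]
    (a : ι → ℕ) (ha : ∑ j, a j ≠ 0) :
    ∑ i, (if a i = 0 then 0 else
      Nat.multinomial Finset.univ (Function.update a i (a i - 1))) =
        Nat.multinomial Finset.univ a := by
  refine Nat.eq_of_mul_eq_mul_left (Nat.pos_of_ne_zero ha) ?_
  rw [Finset.mul_sum, Finset.sum_mul]
  refine Finset.sum_congr rfl fun i _ => ?_
  split_ifs with hi
  · simp [hi]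
  · exact Nat.sum_mul_multinomial_update_pred a hi

/-- A set of at least `Nat.multinomial Finset.univ a` vertices contains a monochromatic clique on
`a i + b i` vertices for some color `i`, provided that `b ≤ 2` and `b` equals `1` at two colors. -/
theorem exists_monochromatic_of_multinomial_le_card {ι V : Type*} [Fintype ι] [DecidableEq ι]
    [DecidableEq V] (C : Sym2 V → ι) (b : ι → ℕ) (hb : ∀ i, b i = 1 ∨ b i = 2)
    {p q : ι} (hpq : p ≠ q) (hp : b p = 1) (hq : b q = 1) (a : ι → ℕ) (S : Finset V)
    (hS : Nat.multinomial Finset.univ a ≤ S.card) :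
    ∃ i, ∃ T ⊆ S, T.card = a i + b i ∧ ∀ x ∈ T, ∀ y ∈ T, x ≠ y → C s(x, y) = i := by
  induction hn : ∑ j, a j generalizing a S with
  | zero =>
    obtain ⟨v, hv⟩ := Finset.card_pos.1 ((Nat.multinomial_pos _ _).trans_le hS)
    have hap : a p = 0 := by simpa using (Finset.sum_eq_zero_iff.1 hn) p (Finset.mem_univ p)
    exact ⟨p, {v}, by simpa using hv, by simp [hap, hp], by simp⟩
  | succ n ih =>
    obtain ⟨v, hv⟩ := Finset.card_pos.1 ((Nat.multinomial_pos _ _).trans_le hS)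
    by_contra! H
    have hone : ∀ i, a i + b i ≠ 1 := fun i hi => by
      obtain ⟨x, hx, y, hy, hxy, -⟩ := H i {v} (by simpa using hv) (by simpa using hi.symm)
      simp only [Finset.mem_singleton] at hx hy
      exact hxy (hx.trans hy.symm)
    set F : ι → Finset V := fun i => (S.erase v).filter (fun x => C s(v, x) = i) with hF
    have hFS : ∀ i, F i ⊆ S := fun i =>
      (Finset.filter_subset _ _).trans (Finset.erase_subset _ _)
    have hvF : ∀ i, v ∉ F i := fun i => by simp [hF]
    have hextend : ∀ i, ∀ T ⊆ F i, (∀ x ∈ T, ∀ y ∈ T, x ≠ y → C s(x, y) = i) →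
        T.card + 1 ≠ a i + b i := by
      intro i T hT hmono hcard
      obtain ⟨x, hx, y, hy, hxy, hne⟩ := H i (insert v T)
        (Finset.insert_subset hv (hT.trans (hFS i)))
        (by rw [Finset.card_insert_of_notMem fun h => hvF i (hT h), hcard])
      have hmem : ∀ z ∈ T, C s(v, z) = i := fun z hz => (Finset.mem_filter.1 (hT hz)).2
      rw [Finset.mem_insert] at hx hy
      rcases hx with rfl | hx <;> rcases hy with rfl | hy
      · exact hxy rfl
      · exact hne (hmem y hy)
      · exact hne (Sym2.eq_swap ▸ hmem x hx)
      · exact hne (hmono x hx y hy hxy)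
    have hbound : ∀ i, (F i).card + (if a i = 0 then 0 else 1) ≤
        if a i = 0 then 0 else
          Nat.multinomial Finset.univ (Function.update a i (a i - 1)) := by
      intro i
      split_ifs with hi
      · by_contra hpos
        obtain ⟨x, hx⟩ := Finset.card_pos.1 (by omega : 0 < (F i).card)
        refine hextend i {x} (by simpa using hx) (by simp) ?_
        have := hone i
        have := hb i
        rw [Finset.card_singleton]
        omega
      · by_contra! hlt
        obtain ⟨j, T, hT, hcard, hmono⟩ := ih (Function.update a i (a i - 1)) (F i) (by omega) (by
          have h := Finset.sum_update_of_mem (Finset.mem_univ i) a (a i - 1)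
          rw [Finset.sdiff_singleton_eq_erase] at h
          have := Finset.add_sum_erase _ a (Finset.mem_univ i)
          omega)
        by_cases hj : j = i
        · subst hj
          rw [Function.update_self] at hcard
          exact hextend j T hT hmono (by omega)
        · rw [Function.update_of_ne hj] at hcard
          obtain ⟨x, hx, y, hy, hxy, hne⟩ := H j T (hT.trans (hFS i)) hcard
          exact hne (hmono x hx y hy hxy)
    have htotal := Finset.sum_le_sum fun i (_ : i ∈ Finset.univ) => hbound i
    rw [Finset.sum_add_distrib, Nat.sum_multinomial_update_pred a (by omega)] at htotal
    have hfib : ∑ i, (F i).card = (S.erase v).card :=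
      (Finset.card_eq_sum_card_fiberwise fun _ _ => Finset.mem_coe.2 (Finset.mem_univ _)).symm
    have htwo : 2 ≤ ∑ i, (if a i = 0 then 0 else 1) := by
      have hpair : ∑ i ∈ {p, q}, (if a i = 0 then 0 else 1) ≤ ∑ i, (if a i = 0 then 0 else 1) :=
        Finset.sum_le_sum_of_subset (Finset.subset_univ _)
      have := hone p
      have := hone q
      rwa [Finset.sum_pair hpq, if_neg (by omega), if_neg (by omega)] at hpair
    have := Finset.card_erase_add_one hv
    omega

theorem stmt_4 (r : ℕ) (hr : 2 ≤ r) (k : Fin r → ℕ) (hk : ∀ i, 2 ≤ k i) :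
    ramseyNumber r k ≤
      Nat.multinomial Finset.univ (fun i : Fin r => if (i : ℕ) < 2 then k i - 1 else k i - 2) ∧
    (Nat.multinomial Finset.univ (fun i : Fin r => if (i : ℕ) < 2 then k i - 1 else k i - 2) : ℝ) =
      (((∑ i : Fin r, k i) - 2 * r + 2).factorial : ℝ) /
        ∏ i : Fin r, (((if (i : ℕ) < 2 then k i - 1 else k i - 2) : ℕ).factorial : ℝ) := by
  set a : Fin r → ℕ := fun i => if (i : ℕ) < 2 then k i - 1 else k i - 2 with ha
  set b : Fin r → ℕ := fun i => if (i : ℕ) < 2 then 1 else 2 with hb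
  have hab : ∀ i, a i + b i = k i := fun i => by
    have := hk i
    simp only [ha, hb]
    split_ifs <;> omega
  refine ⟨Nat.sInf_le fun C => ?_, ?_⟩
  · obtain ⟨i, T, -, hcard, hmono⟩ := exists_monochromatic_of_multinomial_le_card C b
      (fun i => by simp only [hb]; split_ifs <;> simp)
      (p := ⟨0, by omega⟩) (q := ⟨1, by omega⟩) (by simp) (by simp [hb]) (by simp [hb]) a
      Finset.univ (by simp)
    exact ⟨i, T, hcard.trans (hab i), hmono⟩
  · have hsumb : (∑ i, b i) + 2 = 2 * r := by
      obtain ⟨s, rfl⟩ := Nat.exists_eq_add_of_le' hr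
      simp only [hb, Fin.sum_univ_succ]
      simp
      ring
    have hsum : ∑ i, a i = (∑ i, k i) - 2 * r + 2 := by
      have hk_sum : (∑ i, a i) + ∑ i, b i = ∑ i, k i := by
        rw [← Finset.sum_add_distrib]
        exact Finset.sum_congr rfl fun i _ => hab i
      have hle : 2 * r ≤ ∑ i, k i := by
        simpa [mul_comm] using Finset.sum_le_sum fun i (_ : i ∈ Finset.univ) => hk i
      omega
    rw [eq_div_iff (Finset.prod_ne_zero_iff.2 fun i _ => by positivity), ← hsum,
      ← Nat.multinomial_spec, mul_comm]
    push_cast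
    rfl
end

section
/- For every integer r ≥ 1, the diagonal Ramsey number satisfies R_r(3) ≤ e_r · r! + 1, where e_r = Σ_{n=0}^r 1/n!. -/
/-- The natural number `r! * ∑ n ≤ r, 1 / n!`, defined by its recursion. -/
def factorialPartialExp : ℕ → ℕ
  | 0 => 1
  | r + 1 => (r + 1) * factorialPartialExp r + 1

theorem cast_factorialPartialExp (r : ℕ) :
    (factorialPartialExp r : ℝ) =
      (∑ n ∈ Finset.range (r + 1), (1 : ℝ) / n.factorial) * r.factorial := by
  induction r with
  | zero => simp [factorialPartialExp]
  | succ r ih =>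
    have h : ((r + 1).factorial : ℝ) ≠ 0 := by positivity
    rw [Finset.sum_range_succ, add_mul, one_div_mul_cancel h, factorialPartialExp]
    push_cast [Nat.factorial_succ]
    rw [ih]
    ring

/-- A coloring of the pairs from `S` with colors in `T` has a monochromatic triangle as soon as
`S` has more than `factorialPartialExp T.card` elements. -/
theorem exists_monochromatic_triangle {V ι : Type*} [DecidableEq V] [DecidableEq ι]
    (c : Sym2 V → ι) (T : Finset ι) (S : Finset V) (hS : factorialPartialExp T.card < S.card)
    (hc : ∀ x ∈ S, ∀ y ∈ S, x ≠ y → c s(x, y) ∈ T) :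
    ∃ i, ∃ x y z, x ≠ y ∧ x ≠ z ∧ y ≠ z ∧ c s(x, y) = i ∧ c s(x, z) = i ∧ c s(y, z) = i := by
  induction hr : T.card generalizing T S with
  | zero =>
    rw [hr, factorialPartialExp] at hS
    obtain ⟨x, hx, y, hy, hxy⟩ := Finset.one_lt_card.mp hS
    have := hc x hx y hy hxy
    simp_all
  | succ r ih =>
    rw [hr, factorialPartialExp] at hS
    obtain ⟨v, hv⟩ : S.Nonempty := Finset.card_pos.mp (by omega)
    obtain ⟨i, hi, hF⟩ := Finset.exists_lt_card_fiber_of_mul_lt_card_of_maps_to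
      (s := S.erase v) (t := T) (f := fun x => c s(v, x)) (n := factorialPartialExp r)
      (fun x hx => hc v hv x (Finset.mem_of_mem_erase hx) (Finset.ne_of_mem_erase hx).symm)
      (by rw [hr, Finset.card_erase_of_mem hv]; omega)
    by_cases h : ∃ x ∈ S.erase v, ∃ y ∈ S.erase v,
        x ≠ y ∧ c s(v, x) = i ∧ c s(v, y) = i ∧ c s(x, y) = i
    · obtain ⟨x, hx, y, hy, hxy, hvx, hvy, hcxy⟩ := h
      exact ⟨i, v, x, y, (Finset.ne_of_mem_erase hx).symm, (Finset.ne_of_mem_erase hy).symm,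
        hxy, hvx, hvy, hcxy⟩
    · push Not at h
      have hcard : (T.erase i).card = r := by rw [Finset.card_erase_of_mem hi, hr]; rfl
      refine ih (T.erase i) _ (by rwa [hcard]) (fun x hx y hy hxy => ?_) hcard
      obtain ⟨hxS, hvx⟩ := Finset.mem_filter.mp hx
      obtain ⟨hyS, hvy⟩ := Finset.mem_filter.mp hy
      exact Finset.mem_erase.mpr ⟨h x hxS y hyS hxy hvx hvy,
        hc x (Finset.mem_of_mem_erase hxS) y (Finset.mem_of_mem_erase hyS) hxy⟩

theorem ramseyProp_three (r : ℕ) :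
    RamseyProp (factorialPartialExp r + 1) r (fun _ => 3) := by
  intro C
  obtain ⟨i, x, y, z, hxy, hxz, hyz, h₁, h₂, h₃⟩ :=
    exists_monochromatic_triangle C Finset.univ Finset.univ (by simp) (by simp)
  refine ⟨i, {x, y, z}, Finset.card_eq_three.mpr ⟨x, y, z, hxy, hxz, hyz, rfl⟩, ?_⟩
  have h₁' := Sym2.eq_swap (a := x) (b := y) ▸ h₁
  have h₂' := Sym2.eq_swap (a := x) (b := z) ▸ h₂
  have h₃' := Sym2.eq_swap (a := y) (b := z) ▸ h₃
  simp only [Finset.mem_insert, Finset.mem_singleton]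
  rintro a (rfl | rfl | rfl) b (rfl | rfl | rfl) hab <;> first | exact absurd rfl hab | assumption

theorem stmt_5 (r : ℕ) (hr : 1 ≤ r) :
    (ramseyNumber r (fun _ => 3) : ℝ) ≤
      (∑ n ∈ Finset.range (r + 1), (1 : ℝ) / n.factorial) * r.factorial + 1 := by
  rw [← cast_factorialPartialExp]
  exact_mod_cast Nat.sInf_le (ramseyProp_three r)
end

section
/- For integers r ≥ 2 and k_1, …, k_r ≥ 2, the Ramsey number satisfies R_r(k_1,…,k_r) ≤ M_r(k_1,…,k_r) − w_r(k_1,…,k_r), where M_r and w_r are the unique functions satisfying properties (i)–(iii); moreover these properties uniquely determine M_r and w_r, and both are invariant under permutation of their coordinates. -/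
/-- Properties (i)–(iii) characterizing the main term `M_r` and the waste function `w_r`:
(i) `M_2(k₁,k₂) = C(k₁+k₂-2, k₁-1)` and `w_2(k₁,k₂) = 0`;
(ii) both functions "ignore 2's": if a coordinate of an `(r+1)`-tuple equals `2`, the value
equals that of the `r`-tuple with that coordinate removed;
(iii) if all coordinates are at least `3`, `M_r` satisfies the multinomial-type recurrence and
`w_r` satisfies the same recurrence with an extra additive `r - 2`. -/
def MwProps (M w : ∀ r : ℕ, (Fin r → ℕ) → ℕ) : Prop :=
  (∀ k : Fin 2 → ℕ, (∀ i, 2 ≤ k i) →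
      M 2 k = Nat.choose (k 0 + k 1 - 2) (k 0 - 1) ∧ w 2 k = 0) ∧
  (∀ r : ℕ, 2 ≤ r → ∀ k : Fin (r + 1) → ℕ, (∀ i, 2 ≤ k i) → ∀ i : Fin (r + 1), k i = 2 →
      M (r + 1) k = M r (k ∘ i.succAbove) ∧ w (r + 1) k = w r (k ∘ i.succAbove)) ∧
  (∀ r : ℕ, 2 ≤ r → ∀ k : Fin r → ℕ, (∀ i, 3 ≤ k i) →
      M r k = ∑ i : Fin r, M r (Function.update k i (k i - 1)) ∧
      w r k = (∑ i : Fin r, w r (Function.update k i (k i - 1))) + (r - 2))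

/-- An admissible tuple is reached from pairs with a coordinate `2` by inserting coordinates
equal to `2` and by incrementing coordinates of tuples. -/
theorem tuple_induction {P : ∀ r : ℕ, (Fin r → ℕ) → Prop}
    (base : ∀ k : Fin 2 → ℕ, (∀ i, 2 ≤ k i) → ∀ i, k i = 2 → P 2 k)
    (insert : ∀ r, 2 ≤ r → ∀ k : Fin (r + 1) → ℕ, (∀ i, 2 ≤ k i) → ∀ i, k i = 2 →
      P r (k ∘ i.succAbove) → P (r + 1) k)
    (incr : ∀ r, 2 ≤ r → ∀ k : Fin r → ℕ, (∀ i, 3 ≤ k i) →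
      (∀ i, P r (Function.update k i (k i - 1))) → P r k)
    (r : ℕ) (hr : 2 ≤ r) (k : Fin r → ℕ) (hk : ∀ i, 2 ≤ k i) : P r k := by
  induction hn : ∑ i, k i using Nat.strong_induction_on generalizing r k with
  | _ n ih =>
    subst hn
    by_cases h : ∃ i, k i = 2
    · obtain ⟨i, hi⟩ := h
      obtain rfl | ⟨r, rfl⟩ : r = 2 ∨ ∃ s, r = s + 1 + 2 := by
        rcases Nat.exists_eq_add_of_le hr with ⟨_ | s, rfl⟩
        · exact Or.inl rfl
        · exact Or.inr ⟨s, by omega⟩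
      · exact base k hk i hi
      · refine insert (r + 2) (by omega) k hk i hi
          (ih _ ?_ _ (by omega) _ (fun j => hk _) rfl)
        rw [Fin.sum_univ_succAbove k i]
        simp only [Function.comp_apply]
        omega
    · have h3 : ∀ i, 3 ≤ k i := fun i =>
        lt_of_le_of_ne (hk i) fun e => h ⟨i, e.symm⟩
      refine incr r hr k h3 fun i => ih _ ?_ r hr _ ?_ rfl
      · refine Finset.sum_lt_sum (fun j _ => ?_) ⟨i, Finset.mem_univ i, ?_⟩
        · rcases eq_or_ne j i with rfl | hj
          · simp
          · simp [hj]
        · have := h3 i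
          simp
          omega
      · intro j
        have := h3 j
        rcases eq_or_ne j i with rfl | hj
        · simp
          omega
        · simpa [hj] using hk j

/-- The recursion common to `M_r` and `w_r`, with `n` the number of remaining steps: tuples with
at most one coordinate at least `3` take the value `b n`, and on other tuples the recurrence adds
`e` of the number of coordinates at least `3`. -/
def tupleRec (b e : ℕ → ℕ) : ℕ → ∀ r : ℕ, (Fin r → ℕ) → ℕ
  | 0, _, _ => b 0
  | n + 1, r, k =>
    if 2 ≤ ∑ i : Fin r, (if 3 ≤ k i then 1 else 0) then
      (∑ i : Fin r, if 3 ≤ k i then tupleRec b e n r (Function.update k i (k i - 1)) else 0) +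
        e (∑ i : Fin r, (if 3 ≤ k i then 1 else 0))
    else b (n + 1)

theorem tupleRec_comp_perm (b e : ℕ → ℕ) (n r : ℕ) (k : Fin r → ℕ) (σ : Equiv.Perm (Fin r)) :
    tupleRec b e n r (k ∘ σ) = tupleRec b e n r k := by
  induction n generalizing k with
  | zero => rfl
  | succ n ih =>
    have hc : ∑ i : Fin r, (if 3 ≤ (k ∘ σ) i then 1 else 0) =
        ∑ i : Fin r, (if 3 ≤ k i then 1 else 0) :=
      Equiv.sum_comp σ fun i => if 3 ≤ k i then 1 else 0
    have hs : (∑ i : Fin r, if 3 ≤ (k ∘ σ) i then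
          tupleRec b e n r (Function.update (k ∘ σ) i ((k ∘ σ) i - 1)) else 0) =
        ∑ i : Fin r, if 3 ≤ k i then tupleRec b e n r (Function.update k i (k i - 1)) else 0 := by
      rw [← Equiv.sum_comp σ fun i =>
        if 3 ≤ k i then tupleRec b e n r (Function.update k i (k i - 1)) else 0]
      refine Finset.sum_congr rfl fun i _ => ?_
      simp only [Function.comp_apply]
      rw [← ih (Function.update k (σ i) (k (σ i) - 1)),
        Function.update_comp_eq_of_injective k σ.injective]
    simp only [tupleRec, hc, hs]

theorem tupleRec_succAbove (b e : ℕ → ℕ) (n r : ℕ) (k : Fin (r + 1) → ℕ) (i : Fin (r + 1))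
    (hi : k i = 2) : tupleRec b e n (r + 1) k = tupleRec b e n r (k ∘ i.succAbove) := by
  induction n generalizing k with
  | zero => rfl
  | succ n ih =>
    have hs (j : Fin r) : tupleRec b e n (r + 1)
          (Function.update k (i.succAbove j) (k (i.succAbove j) - 1)) =
        tupleRec b e n r
          (Function.update (k ∘ i.succAbove) j ((k ∘ i.succAbove) j - 1)) := by
      rw [ih _ (by simp [hi]),
        Function.update_comp_eq_of_injective k Fin.succAbove_right_injective]
      rfl
    simp only [tupleRec, Fin.sum_univ_succAbove _ i, hi, hs, Function.comp_apply]
    simp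

/-- The recursion run for exactly as many steps as the tuple allows. -/
def tupleVal (b e : ℕ → ℕ) (r : ℕ) (k : Fin r → ℕ) : ℕ :=
  tupleRec b e (∑ i, (k i - 2)) r k

theorem tupleVal_comp_perm (b e : ℕ → ℕ) (r : ℕ) (k : Fin r → ℕ) (σ : Equiv.Perm (Fin r)) :
    tupleVal b e r (k ∘ σ) = tupleVal b e r k := by
  rw [tupleVal, tupleVal, tupleRec_comp_perm]
  congr 1
  exact Equiv.sum_comp σ fun i => k i - 2

theorem tupleVal_succAbove (b e : ℕ → ℕ) (r : ℕ) (k : Fin (r + 1) → ℕ) (i : Fin (r + 1))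
    (hi : k i = 2) : tupleVal b e (r + 1) k = tupleVal b e r (k ∘ i.succAbove) := by
  rw [tupleVal, tupleVal, tupleRec_succAbove b e _ r k i hi, Fin.sum_univ_succAbove _ i, hi]
  simp

theorem tupleVal_eq_sum (b e : ℕ → ℕ) (r : ℕ) (hr : 2 ≤ r) (k : Fin r → ℕ)
    (hk : ∀ i, 3 ≤ k i) :
    tupleVal b e r k = (∑ i, tupleVal b e r (Function.update k i (k i - 1))) + e r := by
  have hn (i : Fin r) : ∑ j, (k j - 2) =
      (∑ j, (Function.update k i (k i - 1) j - 2)) + 1 := by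
    have h := hk i
    rw [← Finset.add_sum_erase _ _ (Finset.mem_univ i),
      ← Finset.add_sum_erase _ (fun j => Function.update k i (k i - 1) j - 2)
        (Finset.mem_univ i)]
    have : ∑ j ∈ Finset.univ.erase i, (Function.update k i (k i - 1) j - 2) =
        ∑ j ∈ Finset.univ.erase i, (k j - 2) :=
      Finset.sum_congr rfl fun j hj => by
        rw [Function.update_of_ne (Finset.ne_of_mem_erase hj)]
    simp only [this, Function.update_self]
    omega
  obtain ⟨n, hn'⟩ : ∃ n, ∑ j, (k j - 2) = n + 1 := ⟨_, hn ⟨0, by omega⟩⟩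
  have hn'' (i : Fin r) : ∑ j, (Function.update k i (k i - 1) j - 2) = n := by
    have := hn i
    omega
  simp only [tupleVal, hn', hn'', tupleRec, hk, if_true]
  simp [hr]

/-- On a pair with a coordinate `2` the recursion takes its initial value. -/
theorem tupleVal_pair (b e : ℕ → ℕ) (k : Fin 2 → ℕ) (i : Fin 2) (hi : k i = 2) :
    tupleVal b e 2 k = b (∑ j, (k j - 2)) := by
  rw [tupleVal]
  cases ∑ j, (k j - 2) with
  | zero => rfl
  | succ n =>
    rw [tupleRec, if_neg]
    rw [Fin.sum_univ_succAbove _ i, hi]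
    simp only [Fin.sum_univ_one]
    split_ifs <;> omega

theorem choose_pair_of_eq_two (k : Fin 2 → ℕ) (hk : ∀ i, 2 ≤ k i) (i : Fin 2) (hi : k i = 2) :
    Nat.choose (k 0 + k 1 - 2) (k 0 - 1) = k (i.succAbove 0) := by
  fin_cases i
  · simp only [Fin.zero_eta] at hi
    simp [hi]
  · simp only [Fin.mk_one] at hi
    have := hk 0
    simp only [hi, Nat.add_sub_cancel]
    obtain ⟨m, hm⟩ : ∃ m, k 0 = m + 1 := ⟨k 0 - 1, by omega⟩
    simp [hm]

theorem choose_pair_succ (a b : ℕ) (ha : 3 ≤ a) (hb : 3 ≤ b) :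
    Nat.choose (a + b - 2) (a - 1) =
      Nat.choose (a - 1 + b - 2) (a - 1 - 1) + Nat.choose (a + (b - 1) - 2) (a - 1) := by
  obtain ⟨a, rfl⟩ := Nat.exists_eq_add_of_le' ha
  obtain ⟨b, rfl⟩ := Nat.exists_eq_add_of_le' hb
  have h₁ : a + 3 + (b + 3) - 2 = a + b + 3 + 1 := by omega
  have h₂ : a + 3 - 1 + (b + 3) - 2 = a + b + 3 := by omega
  have h₃ : a + 3 + (b + 3 - 1) - 2 = a + b + 3 := by omega
  rw [h₁, h₂, h₃]
  exact Nat.choose_succ_succ _ _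

theorem mwProps_tupleVal :
    MwProps (tupleVal (· + 2) fun _ => 0) (tupleVal (fun _ => 0) (· - 2)) := by
  refine ⟨fun k hk => ?_, fun r _ k _ i hi =>
    ⟨tupleVal_succAbove _ _ r k i hi, tupleVal_succAbove _ _ r k i hi⟩,
    fun r hr k hk => ⟨tupleVal_eq_sum _ _ r hr k hk, tupleVal_eq_sum _ _ r hr k hk⟩⟩
  suffices ∀ r, 2 ≤ r → ∀ k : Fin r → ℕ, (∀ i, 2 ≤ k i) → ∀ hr : r = 2,
      tupleVal (· + 2) (fun _ => 0) r k =
        Nat.choose (k ⟨0, by omega⟩ + k ⟨1, by omega⟩ - 2) (k ⟨0, by omega⟩ - 1) ∧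
      tupleVal (fun _ => 0) (· - 2) r k = 0 from this 2 le_rfl k hk rfl
  refine tuple_induction ?_ ?_ ?_
  · rintro k hk i hi -
    refine ⟨?_, tupleVal_pair _ _ k i hi⟩
    rw [tupleVal_pair _ _ k i hi, Fin.sum_univ_succAbove _ i, hi]
    refine Eq.trans ?_ (choose_pair_of_eq_two k hk i hi).symm
    have := hk (i.succAbove 0)
    simp
    omega
  · intros
    omega
  · rintro r hr k hk ih rfl
    rw [tupleVal_eq_sum _ _ 2 hr k hk, tupleVal_eq_sum _ _ 2 hr k hk]
    simp only [Fin.sum_univ_two, (ih 0 rfl).1, (ih 1 rfl).1, (ih 0 rfl).2, (ih 1 rfl).2]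
    refine ⟨?_, by simp⟩
    simpa using (choose_pair_succ (k 0) (k 1) (hk 0) (hk 1)).symm

theorem MwProps.unique {M₁ w₁ M₂ w₂ : ∀ r : ℕ, (Fin r → ℕ) → ℕ} (h₁ : MwProps M₁ w₁)
    (h₂ : MwProps M₂ w₂) (r : ℕ) (hr : 2 ≤ r) (k : Fin r → ℕ) (hk : ∀ i, 2 ≤ k i) :
    M₁ r k = M₂ r k ∧ w₁ r k = w₂ r k := by
  refine tuple_induction (P := fun r k => M₁ r k = M₂ r k ∧ w₁ r k = w₂ r k) ?_ ?_ ?_ r hr k hk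
  · intro k hk _ _
    rw [(h₁.1 k hk).1, (h₁.1 k hk).2, (h₂.1 k hk).1, (h₂.1 k hk).2]
    exact ⟨rfl, rfl⟩
  · intro r hr k hk i hi ih
    rw [(h₁.2.1 r hr k hk i hi).1, (h₁.2.1 r hr k hk i hi).2,
      (h₂.2.1 r hr k hk i hi).1, (h₂.2.1 r hr k hk i hi).2]
    exact ih
  · intro r hr k hk ih
    rw [(h₁.2.2 r hr k hk).1, (h₁.2.2 r hr k hk).2, (h₂.2.2 r hr k hk).1, (h₂.2.2 r hr k hk).2]
    exact ⟨Finset.sum_congr rfl fun i _ => (ih i).1,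
      congrArg (· + (r - 2)) (Finset.sum_congr rfl fun i _ => (ih i).2)⟩

theorem MwProps.comp_perm {M w : ∀ r : ℕ, (Fin r → ℕ) → ℕ} (h : MwProps M w) (r : ℕ)
    (hr : 2 ≤ r) (k : Fin r → ℕ) (hk : ∀ i, 2 ≤ k i) (σ : Equiv.Perm (Fin r)) :
    M r (k ∘ σ) = M r k ∧ w r (k ∘ σ) = w r k := by
  have h₁ := h.unique mwProps_tupleVal r hr k hk
  have h₂ := h.unique mwProps_tupleVal r hr (k ∘ σ) fun i => hk _
  rw [h₁.1, h₁.2, h₂.1, h₂.2]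
  exact ⟨tupleVal_comp_perm _ _ r k σ, tupleVal_comp_perm _ _ r k σ⟩

/-- A set of at least `n` vertices contains a clique as provided by `RamseyProp n r k`. -/
theorem RamseyProp.exists_subset {n N r : ℕ} {k : Fin r → ℕ} (h : RamseyProp n r k)
    (C : Sym2 (Fin N) → Fin r) (T : Finset (Fin N)) (hT : n ≤ T.card) :
    ∃ i, ∃ S ⊆ T, S.card = k i ∧ ∀ x ∈ S, ∀ y ∈ S, x ≠ y → C s(x, y) = i := by
  let f : Fin n ↪ Fin N := (Fin.castLEEmb hT).trans (T.orderEmbOfFin rfl).toEmbedding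
  obtain ⟨i, S, hS, hC⟩ := h fun s => C (s.map f)
  refine ⟨i, S.map f, ?_, by simpa using hS, ?_⟩
  · intro x hx
    obtain ⟨a, -, rfl⟩ := Finset.mem_map.1 hx
    exact Finset.orderEmbOfFin_mem T rfl _
  · intro x hx y hy hxy
    obtain ⟨a, ha, rfl⟩ := Finset.mem_map.1 hx
    obtain ⟨b, hb, rfl⟩ := Finset.mem_map.1 hy
    exact hC a ha b hb fun e => hxy (e ▸ rfl)

theorem RamseyProp.pos {n r : ℕ} {k : Fin r → ℕ} (h : RamseyProp n r k) (hr : 0 < r)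
    (hk : ∀ i, 0 < k i) : 0 < n := by
  obtain ⟨i, S, hS, -⟩ := h fun _ => ⟨0, hr⟩
  have h₁ := hk i
  have h₂ := S.card_le_univ
  rw [Fintype.card_fin] at h₂
  omega

theorem ramseyProp_one (k : Fin 1 → ℕ) : RamseyProp (k 0) 1 k := fun _ =>
  ⟨0, Finset.univ, by simp, fun _ _ _ _ _ => Subsingleton.elim _ _⟩

/-- A coordinate equal to `2` can be dropped. -/
theorem RamseyProp.of_succAbove {n r : ℕ} (hr : 0 < r) {k : Fin (r + 1) → ℕ} {i : Fin (r + 1)}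
    (hi : k i = 2) (h : RamseyProp n r (k ∘ i.succAbove)) : RamseyProp n (r + 1) k := by
  intro C
  by_cases hC : ∃ x y, x ≠ y ∧ C s(x, y) = i
  · obtain ⟨x, y, hxy, hCi⟩ := hC
    refine ⟨i, {x, y}, by rw [hi, Finset.card_pair hxy], fun a ha b hb hab => ?_⟩
    simp only [Finset.mem_insert, Finset.mem_singleton] at ha hb
    rcases ha with rfl | rfl <;> rcases hb with rfl | rfl
    · exact absurd rfl hab
    · exact hCi
    · rwa [Sym2.eq_swap]
    · exact absurd rfl hab
  · have : ∀ s, ∃ c : Fin r, C s ≠ i → i.succAbove c = C s := fun s => by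
      by_cases hs : C s = i
      · exact ⟨⟨0, hr⟩, fun h => absurd hs h⟩
      · obtain ⟨c, hc⟩ := Fin.exists_succAbove_eq hs
        exact ⟨c, fun _ => hc⟩
    choose C' hC' using this
    obtain ⟨c, S, hS, hSC⟩ := h C'
    refine ⟨i.succAbove c, S, hS, fun x hx y hy hxy => ?_⟩
    rw [← hC' _ fun e => hC ⟨x, y, hxy, e⟩, hSC x hx y hy hxy]

/-- The multicolor Erdős–Szekeres recurrence, by pigeonhole on the edges at one vertex. -/
theorem RamseyProp.of_update {N r : ℕ} {k n : Fin r → ℕ} (hk : ∀ i, 0 < k i)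
    (h : ∀ i, RamseyProp (n i) r (Function.update k i (k i - 1)))
    (hN : ∑ i, n i + 2 ≤ N + r) (hN₀ : 0 < N) : RamseyProp N r k := by
  intro C
  let v : Fin N := ⟨0, hN₀⟩
  let T (i : Fin r) : Finset (Fin N) := (Finset.univ.erase v).filter fun x => C s(v, x) = i
  obtain ⟨i, hi⟩ : ∃ i, n i ≤ (T i).card := by
    by_contra! hlt
    have h₁ : ∑ i, (T i).card = N - 1 := by
      rw [← Finset.card_eq_sum_card_fiberwise (fun _ _ => Finset.mem_coe.2 (Finset.mem_univ _)),
        Finset.card_erase_of_mem (Finset.mem_univ v), Finset.card_univ, Fintype.card_fin]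
    have h₂ : ∑ i, ((T i).card + 1) ≤ ∑ i, n i := Finset.sum_le_sum fun i _ => hlt i
    rw [Finset.sum_add_distrib, h₁] at h₂
    simp at h₂
    omega
  obtain ⟨j, S, hST, hS, hSC⟩ := (h i).exists_subset C (T i) hi
  rcases eq_or_ne j i with rfl | hj
  · rw [Function.update_self] at hS
    have hv : ∀ x ∈ S, x ≠ v ∧ C s(v, x) = j := fun x hx => by
      simpa [T] using hST hx
    refine ⟨j, insert v S, ?_, fun x hx y hy hxy => ?_⟩
    · rw [Finset.card_insert_of_notMem fun h => (hv v h).1 rfl, hS]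
      have := hk j
      omega
    · rcases Finset.mem_insert.1 hx with rfl | hx <;> rcases Finset.mem_insert.1 hy with rfl | hy
      · exact absurd rfl hxy
      · exact (hv y hy).2
      · rw [Sym2.eq_swap]
        exact (hv x hx).2
      · exact hSC x hx y hy hxy
  · rw [Function.update_of_ne hj] at hS
    exact ⟨j, S, hS, hSC⟩

theorem MwProps.ramseyProp {M w : ∀ r : ℕ, (Fin r → ℕ) → ℕ} (h : MwProps M w) (r : ℕ)
    (hr : 2 ≤ r) (k : Fin r → ℕ) (hk : ∀ i, 2 ≤ k i) : RamseyProp (M r k - w r k) r k := by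
  refine tuple_induction (P := fun r k => RamseyProp (M r k - w r k) r k) ?_ ?_ ?_ r hr k hk
  · intro k hk i hi
    rw [(h.1 k hk).1, (h.1 k hk).2, choose_pair_of_eq_two k hk i hi]
    exact .of_succAbove one_pos hi (ramseyProp_one (k ∘ i.succAbove))
  · intro r hr k hk i hi ih
    rw [(h.2.1 r hr k hk i hi).1, (h.2.1 r hr k hk i hi).2]
    exact .of_succAbove (by omega) hi ih
  · intro r hr k hk ih
    have hpos (i : Fin r) : 0 < M r (Function.update k i (k i - 1)) -
        w r (Function.update k i (k i - 1)) := by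
      refine (ih i).pos (by omega) fun j => ?_
      have := hk j
      rcases eq_or_ne j i with rfl | hj
      · simp
        omega
      · simp [hj]
        omega
    have hsub := Finset.sum_tsub_distrib Finset.univ
      (f := fun i => M r (Function.update k i (k i - 1)))
      (g := fun i => w r (Function.update k i (k i - 1)))
      fun i _ => by
        have := hpos i
        omega
    have hle : ∑ _i : Fin r, 1 ≤ ∑ i, (M r (Function.update k i (k i - 1)) -
        w r (Function.update k i (k i - 1))) := Finset.sum_le_sum fun i _ => hpos i
    simp only [Finset.sum_const, Finset.card_univ, Fintype.card_fin, smul_eq_mul, mul_one] at hle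
    refine .of_update (fun i => by have := hk i; omega) ih ?_ ?_
    all_goals
      rw [(h.2.2 r hr k hk).1, (h.2.2 r hr k hk).2]
      omega

theorem stmt_6 :
    (∃ M w : ∀ r : ℕ, (Fin r → ℕ) → ℕ, MwProps M w) ∧
    (∀ M₁ w₁ M₂ w₂ : ∀ r : ℕ, (Fin r → ℕ) → ℕ, MwProps M₁ w₁ → MwProps M₂ w₂ →
      ∀ r : ℕ, 2 ≤ r → ∀ k : Fin r → ℕ, (∀ i, 2 ≤ k i) →
        M₁ r k = M₂ r k ∧ w₁ r k = w₂ r k) ∧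
    (∀ M w : ∀ r : ℕ, (Fin r → ℕ) → ℕ, MwProps M w →
      ∀ r : ℕ, 2 ≤ r → ∀ k : Fin r → ℕ, (∀ i, 2 ≤ k i) →
        (∀ σ : Equiv.Perm (Fin r), M r (k ∘ σ) = M r k ∧ w r (k ∘ σ) = w r k) ∧
        ramseyNumber r k ≤ M r k - w r k) := by
  exact ⟨⟨_, _, mwProps_tupleVal⟩, fun _ _ _ _ h₁ h₂ => h₁.unique h₂, fun _ _ h r hr k hk =>
    ⟨h.comp_perm r hr k hk, Nat.sInf_le (h.ramseyProp r hr k hk)⟩⟩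
end

section
/- For integers r ≥ 2 and k ≥ 2, the diagonal value satisfies M_r(k) ≤ (4 − 2/(k−1)) · (r(k−2))! / ((k−2)!)^r. -/
/-- The closed form of the main term `M_r` at the tuple `(a₁ + 2, …, a_r + 2)`: the multinomial
coefficient of `a` times the correction factor `2 + ∑ⱼ aⱼ / (A - aⱼ + 1)`, where `A = ∑ⱼ aⱼ`. -/
noncomputable def mainTermClosedForm {r : ℕ} (a : Fin r → ℕ) : ℝ :=
  ((∑ i, a i).factorial : ℝ) / (∏ i, ((a i).factorial : ℝ)) *
    (2 + ∑ j, (a j : ℝ) / ((∑ i, (a i : ℝ)) - a j + 1))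

theorem mainTermClosedForm_two (a : Fin 2 → ℕ) :
    mainTermClosedForm a = ((a 0 + a 1 + 2).choose (a 0 + 1) : ℝ) := by
  have h := Nat.add_choose_mul_factorial_mul_factorial (a 1 + 1) (a 0 + 1)
  rw [show a 1 + 1 + (a 0 + 1) = a 0 + a 1 + 2 by ring] at h
  have h' := congrArg (Nat.cast : ℕ → ℝ) h
  simp only [Nat.factorial_succ] at h'
  push_cast at h'
  have h0 : ((a 0).factorial : ℝ) ≠ 0 := by positivity
  have h1 : ((a 1).factorial : ℝ) ≠ 0 := by positivity
  have h2 : (a 0 : ℝ) + 1 ≠ 0 := by positivity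
  have h3 : (a 1 : ℝ) + 1 ≠ 0 := by positivity
  simp only [mainTermClosedForm, Fin.sum_univ_two, Fin.prod_univ_two, add_sub_cancel_left,
    add_sub_cancel_right]
  field_simp
  linear_combination -h'

theorem mainTermClosedForm_succAbove {r : ℕ} (a : Fin (r + 1) → ℕ) (i : Fin (r + 1))
    (hi : a i = 0) : mainTermClosedForm (a ∘ i.succAbove) = mainTermClosedForm a := by
  simp [mainTermClosedForm, Fin.sum_univ_succAbove _ i, Fin.prod_univ_succAbove _ i, hi]

/-- Decreasing one coordinate of the multinomial coefficient. -/
theorem multinomial_update_sub_one {r : ℕ} (a : Fin r → ℕ) (i : Fin r) (hi : 0 < a i) :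
    ((∑ j, Function.update a i (a i - 1) j).factorial : ℝ) /
        (∏ j, ((Function.update a i (a i - 1) j).factorial : ℝ)) =
      ((∑ j, a j).factorial : ℝ) / (∏ j, ((a j).factorial : ℝ)) *
        (a i / (∑ j, (a j : ℝ))) := by
  obtain ⟨b, hb⟩ := Nat.exists_eq_succ_of_ne_zero hi.ne'
  have hs : ∑ j, a j = (∑ j, Function.update a i (a i - 1) j) + 1 := by
    rw [Finset.sum_update_of_mem (Finset.mem_univ i),
      ← Finset.add_sum_erase _ _ (Finset.mem_univ i), Finset.sdiff_singleton_eq_erase, hb]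
    simp only [Nat.succ_eq_add_one, Nat.add_sub_cancel]
    ring
  have hp : ∏ j, ((a j).factorial : ℝ) =
      (a i : ℝ) * ∏ j, ((Function.update a i (a i - 1) j).factorial : ℝ) := by
    rw [← Finset.mul_prod_erase _ _ (Finset.mem_univ i),
      ← Finset.mul_prod_erase Finset.univ
        (fun j => ((Function.update a i (a i - 1) j).factorial : ℝ)) (Finset.mem_univ i),
      Finset.prod_congr rfl (g := fun j => ((a j).factorial : ℝ))
        (f := fun j => ((Function.update a i (a i - 1) j).factorial : ℝ))
        (s₁ := Finset.univ.erase i) (fun j hj => by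
          rw [Function.update_of_ne (Finset.ne_of_mem_erase hj)])]
    simp only [Function.update_self, hb, Nat.succ_eq_add_one, Nat.add_sub_cancel,
      Nat.factorial_succ]
    push_cast
    ring
  have hs' : ∑ j, (a j : ℝ) = ((∑ j, Function.update a i (a i - 1) j : ℕ) : ℝ) + 1 := by
    exact_mod_cast hs
  have hai : (a i : ℝ) ≠ 0 := by positivity
  have hq : ∏ j, ((Function.update a i (a i - 1) j).factorial : ℝ) ≠ 0 :=
    Finset.prod_ne_zero_iff.2 fun j _ => by positivity
  rw [hs', hp, hs, Nat.factorial_succ]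
  have : ((∑ j, Function.update a i (a i - 1) j : ℕ) : ℝ) + 1 ≠ 0 := by positivity
  rw [Nat.cast_mul, Nat.cast_add_one]
  field_simp

/-- The closed form satisfies the multinomial recurrence at tuples with positive coordinates. -/
theorem mainTermClosedForm_eq_sum {r : ℕ} (hr : 2 ≤ r) (a : Fin r → ℕ) (ha : ∀ i, 0 < a i) :
    mainTermClosedForm a = ∑ i, mainTermClosedForm (Function.update a i (a i - 1)) := by
  have hlt (j : Fin r) : (a j : ℝ) < ∑ i, (a i : ℝ) := by
    have : Nontrivial (Fin r) := Fin.nontrivial_iff_two_le.2 hr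
    obtain ⟨l, hl⟩ := exists_ne j
    exact_mod_cast Finset.single_lt_sum hl (Finset.mem_univ j) (Finset.mem_univ l)
      (ha l) (fun _ _ _ => Nat.zero_le _)
  have hpos : 0 < ∑ i, (a i : ℝ) :=
    (Nat.cast_nonneg _).trans_lt (hlt ⟨0, by omega⟩)
  have hsum (i : Fin r) :
      ∑ l, (Function.update a i (a i - 1) l : ℝ) = (∑ l, (a l : ℝ)) - 1 := by
    rw [← Finset.add_sum_erase _ _ (Finset.mem_univ i),
      ← Finset.add_sum_erase Finset.univ (fun l => (a l : ℝ)) (Finset.mem_univ i),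
      Finset.sum_congr rfl (g := fun l => (a l : ℝ))
        (f := fun l => (Function.update a i (a i - 1) l : ℝ))
        (s₁ := Finset.univ.erase i) (fun j hj => by
          rw [Function.update_of_ne (Finset.ne_of_mem_erase hj)])]
    rw [Function.update_self, Nat.cast_sub (ha i)]
    push_cast
    ring
  simp only [mainTermClosedForm, multinomial_update_sub_one a _ (ha _), hsum]
  set A := ∑ i, (a i : ℝ) with hA
  have key (j : Fin r) :
      ∑ i, (a i : ℝ) * ((Function.update a i (a i - 1) j : ℝ) /
        (A - 1 - (Function.update a i (a i - 1) j : ℝ) + 1)) =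
      A * (a j / (A - a j + 1)) := by
    have h1 : A - a j ≠ 0 := (sub_pos.2 (hlt j)).ne'
    have h2 : A - a j + 1 ≠ 0 := by linarith [hlt j]
    have hrest : ∑ i ∈ Finset.univ.erase j, (a i : ℝ) = A - a j := by
      rw [hA, ← Finset.add_sum_erase Finset.univ _ (Finset.mem_univ j)]
      ring
    rw [← Finset.add_sum_erase _ _ (Finset.mem_univ j),
      Finset.sum_congr rfl (g := fun i => (a i : ℝ) * (a j / (A - a j)))
        (s₁ := Finset.univ.erase j) (fun i hi => by
          rw [Function.update_of_ne (Finset.ne_of_mem_erase hi).symm]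
          ring_nf),
      ← Finset.sum_mul, hrest, Function.update_self, Nat.cast_sub (ha j),
      show A - 1 - ((a j : ℝ) - (1 : ℕ)) + 1 = A - a j + 1 by push_cast; ring]
    push_cast
    field_simp
    ring
  simp only [mul_assoc]
  rw [← Finset.mul_sum]
  congr 1
  simp only [mul_add, div_mul_eq_mul_div, Finset.mul_sum, Finset.sum_add_distrib,
    ← Finset.sum_div]
  rw [← Finset.sum_mul, ← hA, Finset.sum_comm]
  simp only [key]
  rw [← Finset.mul_sum]
  field_simp

/-- The main term is given by its closed form. -/
theorem MwProps.main_eq_closedForm {M w : ∀ r : ℕ, (Fin r → ℕ) → ℕ} (hMw : MwProps M w)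
    {r : ℕ} (hr : 2 ≤ r) (a : Fin r → ℕ) :
    (M r (fun i => a i + 2) : ℝ) = mainTermClosedForm a := by
  obtain ⟨base, drop, step⟩ := hMw
  induction hN : r + ∑ i, a i using Nat.strong_induction_on generalizing r with
  | _ N ih =>
    subst hN
    rcases hr.eq_or_lt with rfl | hr3
    · rw [(base _ fun i => by omega).1, mainTermClosedForm_two]
      congr 2
      omega
    by_cases h0 : ∃ i, a i = 0
    · obtain ⟨i, hi⟩ := h0
      obtain ⟨s, rfl⟩ : ∃ s, r = s + 1 := ⟨r - 1, by omega⟩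
      rw [(drop s (by omega) _ (fun i => by omega) i (by omega)).1,
        ← mainTermClosedForm_succAbove a i hi]
      refine ih _ ?_ (by omega) (a ∘ i.succAbove) rfl
      rw [Fin.sum_univ_succAbove _ i, hi]
      simp only [Function.comp_apply]
      omega
    · have hpos : ∀ i, 0 < a i := fun i => Nat.pos_of_ne_zero fun h => h0 ⟨i, h⟩
      rw [(step r hr _ fun i => by have := hpos i; omega).1, Nat.cast_sum,
        mainTermClosedForm_eq_sum hr a hpos]
      refine Finset.sum_congr rfl fun i _ => ?_
      rw [← ih _ ?_ hr (Function.update a i (a i - 1)) rfl]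
      · congr 2
        funext j
        have := hpos i
        rcases eq_or_ne j i with rfl | hj
        · simp only [Function.update_self]
          omega
        · simp only [Function.update_of_ne hj]
      · refine Nat.add_lt_add_left (Finset.sum_lt_sum (fun j _ => ?_) ⟨i, Finset.mem_univ i, ?_⟩) _
        · rcases eq_or_ne j i with rfl | hj
          · simp
          · simp [hj]
        · have := hpos i
          simp only [Function.update_self]
          omega

theorem stmt_8 (M w : ∀ r : ℕ, (Fin r → ℕ) → ℕ) (hMw : MwProps M w)
    (r k : ℕ) (hr : 2 ≤ r) (hk : 2 ≤ k) :
    (M r (fun _ => k) : ℝ) ≤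
      (4 - 2 / ((k : ℝ) - 1)) * ((r * (k - 2)).factorial : ℝ) /
        ((k - 2).factorial : ℝ) ^ r := by
  obtain ⟨n, rfl⟩ : ∃ n, k = n + 2 := ⟨k - 2, by omega⟩
  rw [hMw.main_eq_closedForm hr (fun _ => n)]
  simp only [mainTermClosedForm, Finset.sum_const, Finset.prod_const, Finset.card_univ,
    Fintype.card_fin, smul_eq_mul, nsmul_eq_mul, Nat.add_sub_cancel]
  rw [mul_comm, mul_div_assoc]
  refine mul_le_mul_of_nonneg_right ?_ (by positivity)
  have hr' : (2 : ℝ) ≤ r := by exact_mod_cast hr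
  have hn : (0 : ℝ) ≤ n := n.cast_nonneg
  push_cast
  rw [show (n : ℝ) + 2 - 1 = n + 1 by ring,
    show (4 : ℝ) - 2 / (n + 1) = 2 + 2 * n / (n + 1) by field_simp; ring]
  rcases n.eq_zero_or_pos with rfl | hn1
  · simp
  have hn1' : (1 : ℝ) ≤ n := by exact_mod_cast hn1
  have hd : 0 < (r : ℝ) * n - n + 1 := by nlinarith
  rw [← mul_div_assoc]
  refine add_le_add_right ((div_le_div_iff₀ hd (by positivity)).2 ?_) 2
  nlinarith [mul_nonneg hn (mul_nonneg (sub_nonneg.2 hr') (sub_nonneg.2 hn1'))]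
end

section
/- For integers r ≥ 2 and k ≥ 3, the diagonal value satisfies M_r(k) = r(r−1) · Σ_{m=3}^{k} m · multinomial(r(k−2)−m+1; k−2, …, k−2, k−3, k−m), where the entry k−2 is repeated r−2 times. -/
open Finset in
/-- Pascal's rule for multinomial coefficients. -/
theorem multinomial_eq_sum_sub_single {ι : Type*} [Fintype ι] [DecidableEq ι] (c : ι → ℕ)
    (hc : c ≠ 0) :
    Nat.multinomial univ c =
      ∑ l, if 0 < c l then Nat.multinomial univ (c - Pi.single l 1) else 0 := by
  have hprod : 0 < ∏ i, (c i).factorial := Finset.prod_pos fun i _ => Nat.factorial_pos _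
  apply Nat.eq_of_mul_eq_mul_left hprod
  rw [Nat.multinomial_spec, Finset.mul_sum]
  have hpos : 0 < ∑ i, c i := by
    obtain ⟨i, hi⟩ := Function.ne_iff.1 hc
    exact (Nat.pos_of_ne_zero hi).trans_le (Finset.single_le_sum (fun _ _ => Nat.zero_le _)
      (mem_univ i))
  have key : ∀ l, (∏ i, (c i).factorial) *
      (if 0 < c l then Nat.multinomial univ (c - Pi.single l 1) else 0) =
        c l * (∑ i, c i - 1).factorial := by
    intro l
    split_ifs with h
    · obtain ⟨d, hd⟩ : ∃ d : ι → ℕ, d = c - Pi.single l 1 := ⟨_, rfl⟩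
      have hl : d l = c l - 1 := by simp [hd]
      have hne : ∀ i ∈ univ.erase l, d i = c i := fun i hi => by
        simp [hd, Finset.ne_of_mem_erase hi]
      rw [← hd]
      have hp : ∏ i, (c i).factorial = c l * ∏ i, (d i).factorial := by
        rw [← Finset.mul_prod_erase _ _ (mem_univ l),
          ← Finset.mul_prod_erase _ (fun i => (d i).factorial) (mem_univ l), ← mul_assoc, hl,
          Nat.mul_factorial_pred h.ne']
        exact congrArg _ (Finset.prod_congr rfl fun i hi => by rw [hne i hi])
      have hs : ∑ i, d i = ∑ i, c i - 1 := by
        rw [← Finset.add_sum_erase _ _ (mem_univ l), ← Finset.add_sum_erase _ c (mem_univ l),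
          Finset.sum_congr rfl hne, hl, Nat.sub_add_comm h]
      rw [hp, mul_assoc, Nat.multinomial_spec, hs]
    · simp [Nat.eq_zero_of_not_pos h]
  simp_rw [key]
  rw [← Finset.sum_mul, Nat.mul_factorial_pred hpos.ne']

open scoped Classical in
/-- The number of descending lattice paths from `a` to `b`. -/
noncomputable def pathCount {ι : Type*} [Fintype ι] (a b : ι → ℕ) : ℕ :=
  if b ≤ a then Nat.multinomial Finset.univ (a - b) else 0

open Finset in
theorem pathCount_eq_sum {ι : Type*} [Fintype ι] [DecidableEq ι] (a b : ι → ℕ) :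
    pathCount a b =
      (∑ l, if 0 < a l then pathCount (a - Pi.single l 1) b else 0) + if a = b then 1 else 0 := by
  by_cases hba : b ≤ a
  · by_cases hab : a = b
    · subst hab
      rw [Finset.sum_eq_zero]
      · simp [pathCount, Nat.multinomial]
      · intro l _
        split_ifs with h
        · refine if_neg fun hle => ?_
          have := hle l
          simp only [Pi.sub_apply, Pi.single_eq_same] at this
          omega
        · rfl
    · have hne : a - b ≠ 0 := fun h => hab (le_antisymm (tsub_eq_zero_iff_le.1 h) hba)
      rw [if_neg hab, add_zero, pathCount, if_pos hba, multinomial_eq_sum_sub_single _ hne]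
      refine Finset.sum_congr rfl fun l _ => ?_
      by_cases hl : b l < a l
      · have hle : b ≤ a - Pi.single l 1 := by
          intro i
          by_cases hi : i = l
          · subst hi
            simp only [Pi.sub_apply, Pi.single_eq_same]
            omega
          · simpa [hi] using hba i
        rw [if_pos (by simpa using hl), if_pos (by omega), pathCount, if_pos hle,
          tsub_right_comm]
      · rw [if_neg (by simpa using hl)]
        split_ifs with h
        · refine (if_neg fun hle => ?_).symm
          have := hle l
          simp only [Pi.sub_apply, Pi.single_eq_same] at this
          omega
        · rfl
  · have hab : a ≠ b := fun h => hba h.ge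
    rw [if_neg hab, pathCount, if_neg hba, Finset.sum_eq_zero]
    intro l _
    split_ifs
    · exact if_neg fun hle => hba (hle.trans tsub_le_self)
    · rfl

open Finset in
/-- A function satisfying the multinomial recurrence at every vector with at least two nonzero
coordinates, and equal to `n + 2` on the axes, is a weighted count of descending lattice paths
ending at the last point before an axis is reached. -/
theorem eq_sum_pathCount {ι : Type*} [Fintype ι] [DecidableEq ι] (φ : (ι → ℕ) → ℕ)
    (hrec : ∀ a : ι → ℕ, (∃ i j, i ≠ j ∧ 0 < a i ∧ 0 < a j) →
      φ a = ∑ l, if 0 < a l then φ (a - Pi.single l 1) else 0)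
    (haxis : ∀ i n, φ (Pi.single i n) = n + 2) (N : ℕ) (a : ι → ℕ) (haN : ∀ i, a i ≤ N)
    (ha : ∃ i j, i ≠ j ∧ 0 < a i ∧ 0 < a j) :
    φ a = ∑ j, ∑ i ∈ univ.erase j, ∑ n ∈ Icc 1 N,
      (n + 2) * pathCount a (Pi.single i n + Pi.single j 1) := by
  induction hs : ∑ i, a i using Nat.strong_induction_on generalizing a with
  | _ s ih =>
  subst hs
  have hsplit : ∀ l, 0 < a l → φ (a - Pi.single l 1) =
      (∑ j, ∑ i ∈ univ.erase j, ∑ n ∈ Icc 1 N,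
        (n + 2) * pathCount (a - Pi.single l 1) (Pi.single i n + Pi.single j 1)) +
      ∑ i ∈ univ.erase l, ∑ n ∈ Icc 1 N,
        (n + 2) * if a = Pi.single i n + Pi.single l 1 then 1 else 0 := by
    intro l hl
    have hadd : a - Pi.single l 1 + Pi.single l 1 = a := tsub_add_cancel_of_le <| by
      intro i
      by_cases hi : i = l
      · subst hi; simpa using Nat.succ_le_of_lt hl
      · simp [hi]
    have heq : ∀ i n, a = Pi.single i n + Pi.single l 1 ↔ a - Pi.single l 1 = Pi.single i n := by
      intro i n
      constructor
      · intro h; rw [h, add_tsub_cancel_right]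
      · intro h; rw [← h, hadd]
    simp_rw [heq]
    set b := a - Pi.single l 1 with hb
    have hba : ∀ i, b i ≤ a i := fun i => Nat.sub_le _ _
    by_cases hb2 : ∃ i j, i ≠ j ∧ 0 < b i ∧ 0 < b j
    · have hlt : ∑ i, b i < ∑ i, a i := by
        refine Finset.sum_lt_sum (fun i _ => hba i) ⟨l, mem_univ l, ?_⟩
        simp only [hb, Pi.sub_apply, Pi.single_eq_same]
        omega
      rw [ih _ hlt b (fun i => (hba i).trans (haN i)) hb2 rfl]
      rw [left_eq_add]
      refine Finset.sum_eq_zero fun i _ => Finset.sum_eq_zero fun n _ => ?_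
      rw [if_neg, mul_zero]
      intro h
      obtain ⟨p, q, hpq, hp, hq⟩ := hb2
      rw [h] at hp hq
      by_cases hpi : p = i
      · subst hpi
        simp [Ne.symm hpq] at hq
      · simp [hpi] at hp
    · push Not at hb2
      obtain ⟨i, hil, hi⟩ : ∃ i, i ≠ l ∧ 0 < a i := by
        obtain ⟨p, q, hpq, hp, hq⟩ := ha
        by_cases hpl : p = l
        · exact ⟨q, fun h => hpq (hpl.trans h.symm), hq⟩
        · exact ⟨p, hpl, hp⟩
      have hbi : b i = a i := by simp [hb, hil]
      have hbs : b = Pi.single i (a i) := by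
        funext x
        by_cases hx : x = i
        · subst hx; simpa using hbi
        · have := hb2 i x (Ne.symm hx) (hbi ▸ hi)
          simp only [Pi.single_eq_of_ne hx]
          omega
      rw [Finset.sum_eq_zero, zero_add]
      · rw [Finset.sum_eq_single_of_mem i (by simp [hil]),
          Finset.sum_eq_single_of_mem (a i) (by simp [haN i]; omega)]
        · rw [if_pos hbs, hbs, haxis, mul_one]
        · intro n _ hn
          rw [if_neg, mul_zero]
          intro h
          apply hn
          have := congrFun h i
          rw [hbi] at this
          simpa using this.symm
        · intro x _ hx
          refine Finset.sum_eq_zero fun n _ => ?_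
          rw [if_neg, mul_zero]
          intro h
          have := congrFun h i
          rw [hbi, Pi.single_eq_of_ne (Ne.symm hx)] at this
          omega
      · intro j _
        refine Finset.sum_eq_zero fun i' hi' => Finset.sum_eq_zero fun n hn => ?_
        rw [pathCount, if_neg, mul_zero]
        intro h
        have hne : i' ≠ j := Finset.ne_of_mem_erase hi'
        have h1 := h i'
        have h2 := h j
        have h3 := hb2 i' j hne
        simp only [Pi.add_apply, Pi.single_eq_same, Pi.single_eq_of_ne hne,
          Pi.single_eq_of_ne hne.symm] at h1 h2
        simp only [mem_Icc] at hn
        omega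
  have hcond : ∀ l i n, (if a = Pi.single i n + Pi.single l 1 then 1 else 0) =
      if 0 < a l then (if a = Pi.single i n + Pi.single l 1 then 1 else 0) else 0 := by
    intro l i n
    by_cases h : 0 < a l
    · rw [if_pos h]
    · rw [if_neg h, if_neg]
      intro h'
      apply h
      rw [h']
      simp
  rw [hrec a ha]
  have hrhs : ∀ j i n, (n + 2) * pathCount a (Pi.single i n + Pi.single j 1) =
      (∑ l, if 0 < a l then
        (n + 2) * pathCount (a - Pi.single l 1) (Pi.single i n + Pi.single j 1) else 0) +
      (if 0 < a j then (n + 2) * (if a = Pi.single i n + Pi.single j 1 then 1 else 0) else 0) := by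
    intro j i n
    rw [pathCount_eq_sum, hcond, mul_add, Finset.mul_sum]
    simp only [mul_ite, mul_zero]
    split_ifs <;> rfl
  simp_rw [hrhs, Finset.sum_add_distrib]
  have hswap : ∀ f : ι → ι → ι → ℕ → ℕ,
      ∑ j, ∑ i ∈ univ.erase j, ∑ n ∈ Icc 1 N, ∑ l, f l j i n =
        ∑ l, ∑ j, ∑ i ∈ univ.erase j, ∑ n ∈ Icc 1 N, f l j i n := by
    intro f
    rw [Finset.sum_comm (s := univ) (t := univ)]
    refine Finset.sum_congr rfl fun j _ => ?_
    rw [Finset.sum_comm (s := univ)]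
    refine Finset.sum_congr rfl fun i _ => ?_
    rw [Finset.sum_comm (s := univ)]
  rw [hswap, ← Finset.sum_add_distrib]
  refine Finset.sum_congr rfl fun l _ => ?_
  split_ifs with h
  · exact hsplit l h
  · simp

namespace MwProps

variable {M w : ∀ r : ℕ, (Fin r → ℕ) → ℕ}

theorem apply_eq_sum (h : MwProps M w) {r : ℕ} (hr : 2 ≤ r) (k : Fin r → ℕ) (hk : ∀ i, 2 ≤ k i)
    (hk' : ∃ i j, i ≠ j ∧ 2 < k i ∧ 2 < k j) :
    M r k = ∑ i, if 2 < k i then M r (Function.update k i (k i - 1)) else 0 := by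
  induction r, hr using Nat.le_induction with
  | base =>
    have hall : ∀ i, 2 < k i := by
      obtain ⟨i, j, hij, hi, hj⟩ := hk'
      intro l
      have : l = i ∨ l = j := by omega
      rcases this with rfl | rfl <;> assumption
    rw [(h.2.2 2 le_rfl k hall).1]
    simp [hall]
  | succ r hr ih =>
    by_cases hall : ∀ i, 2 < k i
    · rw [(h.2.2 (r + 1) (by omega) k hall).1]
      simp [hall]
    · push Not at hall
      obtain ⟨p, hp⟩ := hall
      have hp2 : k p = 2 := le_antisymm hp (hk p)
      rw [(h.2.1 r hr k hk p hp2).1, ih (k ∘ p.succAbove) (fun i => hk _),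
        Fin.sum_univ_succAbove _ p, if_neg (by omega), zero_add]
      · refine Finset.sum_congr rfl fun i _ => ?_
        by_cases hi : 2 < k (p.succAbove i)
        · rw [if_pos hi, Function.comp_apply, if_pos hi,
            (h.2.1 r hr (Function.update k (p.succAbove i) _) ?_ p ?_).1,
            Function.update_comp_eq_of_injective _ Fin.succAbove_right_injective]
          · intro l
            rw [Function.update_apply]
            split_ifs
            · omega
            · exact hk l
          · rw [Function.update_of_ne (Fin.ne_succAbove p i), hp2]
        · rw [if_neg hi, Function.comp_apply, if_neg hi]
      · obtain ⟨i, j, hij, hi, hj⟩ := hk'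
        obtain ⟨i, rfl⟩ := Fin.exists_succAbove_eq (x := i) (y := p) (by rintro rfl; omega)
        obtain ⟨j, rfl⟩ := Fin.exists_succAbove_eq (x := j) (y := p) (by rintro rfl; omega)
        exact ⟨i, j, fun e => hij (e ▸ rfl), hi, hj⟩

theorem apply_eq_of_forall_ne (h : MwProps M w) {r : ℕ} (hr : 2 ≤ r) (k : Fin r → ℕ) (i : Fin r)
    (hi : 2 ≤ k i) (hk : ∀ j, j ≠ i → k j = 2) : M r k = k i := by
  have hk2 : ∀ j, 2 ≤ k j := fun j => by
    by_cases hj : j = i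
    · exact hj ▸ hi
    · exact (hk j hj).ge
  induction r, hr using Nat.le_induction with
  | base =>
    rw [(h.1 k hk2).1]
    obtain rfl | rfl : i = 0 ∨ i = 1 := by omega
    · rw [hk 1 (by decide), Nat.add_sub_cancel, Nat.choose_symm (by omega : 1 ≤ k 0),
        Nat.choose_one_right]
    · rw [hk 0 (by decide), Nat.add_sub_cancel_left, Nat.choose_one_right]
  | succ r hr ih =>
    have : Nontrivial (Fin (r + 1)) := Fin.nontrivial_iff_two_le.2 (by omega)
    obtain ⟨p, hp⟩ := exists_ne i
    obtain ⟨i, rfl⟩ := Fin.exists_succAbove_eq (x := i) (y := p) hp.symm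
    rw [(h.2.1 r hr k hk2 p (hk p hp)).1]
    exact ih (k ∘ p.succAbove) i hi
      (fun j hj => hk _ fun e => hj (Fin.succAbove_right_injective e)) fun j => hk2 _

end MwProps

theorem Nat.multinomial_univ_comp_equiv {ι : Type*} [Fintype ι] (f : ι → ℕ) (e : ι ≃ ι) :
    Nat.multinomial Finset.univ (f ∘ e) = Nat.multinomial Finset.univ f := by
  simp only [Nat.multinomial, Function.comp_apply]
  rw [Equiv.sum_comp e f, Equiv.prod_comp e fun i => (f i).factorial]

theorem Equiv.Perm.exists_apply_eq_and_apply_eq {ι : Type*} [DecidableEq ι] {i j p q : ι}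
    (hij : i ≠ j) (hpq : p ≠ q) : ∃ e : Equiv.Perm ι, e i = p ∧ e j = q := by
  refine ⟨(Equiv.swap i p).trans (Equiv.swap (Equiv.swap i p j) q), ?_, by simp⟩
  rw [Equiv.trans_apply, Equiv.swap_apply_left, Equiv.swap_apply_of_ne_of_ne _ hpq]
  intro h
  exact hij ((Equiv.swap i p).injective (by rw [Equiv.swap_apply_left, ← h]))

theorem stmt_10 (M w : ∀ r : ℕ, (Fin r → ℕ) → ℕ) (hMw : MwProps M w)
    (r k : ℕ) (hr : 2 ≤ r) (hk : 3 ≤ k) :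
    M r (fun _ => k) = r * (r - 1) * ∑ m ∈ Finset.Icc 3 k,
      m * Nat.multinomial Finset.univ
        (fun l : Fin r =>
          if (l : ℕ) < r - 2 then k - 2 else if (l : ℕ) = r - 2 then k - 3 else k - m) := by
  obtain ⟨N, rfl⟩ : ∃ N, k = N + 2 := ⟨k - 2, by omega⟩
  have hp : r - 2 < r := by omega
  have hq : r - 1 < r := by omega
  have hpq : (⟨r - 1, hq⟩ : Fin r) ≠ ⟨r - 2, hp⟩ := by
    simp only [ne_eq, Fin.mk.injEq]; omega
  have hmain := eq_sum_pathCount (fun a : Fin r → ℕ => M r (fun l => a l + 2)) ?_ ?_ N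
    (fun _ => N) (fun _ => le_rfl) ⟨_, _, hpq, by omega, by omega⟩
  · have hpath : ∀ j, ∀ i ∈ Finset.univ.erase j, ∀ n ∈ Finset.Icc 1 N,
        pathCount (fun _ : Fin r => N) (Pi.single i n + Pi.single j 1) =
          Nat.multinomial Finset.univ (fun l : Fin r =>
            if (l : ℕ) < r - 2 then N else if (l : ℕ) = r - 2 then N - 1 else N - n) := by
      intro j i hi n hn
      have hij : i ≠ j := Finset.ne_of_mem_erase hi
      rw [Finset.mem_Icc] at hn
      obtain ⟨e, hei, hej⟩ := Equiv.Perm.exists_apply_eq_and_apply_eq hij hpq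
      rw [pathCount, if_pos]
      · refine (congrArg _ ?_).trans (Nat.multinomial_univ_comp_equiv _ e)
        funext l
        simp only [Pi.sub_apply, Pi.add_apply, Function.comp_apply]
        by_cases hli : l = i
        · subst hli
          rw [hei, if_neg (by simp only; omega), if_neg (by simp only; omega)]
          simp [hij]
        · by_cases hlj : l = j
          · subst hlj
            simp [hej, hli]
          · have h1 : (e l : ℕ) ≠ r - 1 := fun h =>
              hli (e.injective (by rw [hei]; exact Fin.ext h))
            have h2 : (e l : ℕ) ≠ r - 2 := fun h =>
              hlj (e.injective (by rw [hej]; exact Fin.ext h))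
            rw [if_pos (by omega)]
            simp [hli, hlj]
      · intro l
        simp only [Pi.add_apply, Pi.single_apply]
        split_ifs with h1 h2
        · exact absurd (h1.symm.trans h2) hij
        all_goals omega
    rw [hmain, Finset.sum_congr rfl fun j _ => Finset.sum_congr rfl fun i hi =>
      Finset.sum_congr rfl fun n hn => by rw [hpath j i hi n hn]]
    simp only [Finset.sum_const, Finset.card_erase_of_mem (Finset.mem_univ _), Finset.card_univ,
      Fintype.card_fin, smul_eq_mul, ← mul_assoc]
    congr 1
    refine Finset.sum_bij (fun n _ => n + 2) ?_ ?_ ?_ ?_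
    · intro n hn
      simp only [Finset.mem_Icc] at hn ⊢
      omega
    · intro m _ n _ hmn
      omega
    · intro m hm
      simp only [Finset.mem_Icc] at hm
      exact ⟨m - 2, by simp only [Finset.mem_Icc]; omega, by omega⟩
    · intro n _
      simp only [Nat.add_sub_cancel, Nat.add_sub_add_right, show N + 2 - 3 = N - 1 by omega]
  · intro a ha
    obtain ⟨i, j, hij, hi, hj⟩ := ha
    rw [hMw.apply_eq_sum hr _ (fun _ => by omega) ⟨i, j, hij, by omega, by omega⟩]
    refine Finset.sum_congr rfl fun l _ => ?_
    by_cases hl : 0 < a l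
    · rw [if_pos (by omega), if_pos hl]
      congr 1
      funext x
      by_cases hx : x = l
      · subst hx
        simp only [Function.update_self, Pi.sub_apply, Pi.single_eq_same]
        omega
      · simp [hx]
    · rw [if_neg (by omega), if_neg hl]
  · intro i n
    rw [hMw.apply_eq_of_forall_ne hr _ i (by omega) fun j hj => by simp [hj]]
    simp
end

section
/- For each fixed integer k ≥ 3, the ratio M_r(k) · ((k−2)!)^r / (r(k−2))! converges to 3 as r → ∞; equivalently, M_r(k) = 3 · (r(k−2))!/((k−2)!)^r · (1 + o(1)) as r → ∞. -/
open Finset Filter Topology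

/-- The multinomial coefficient of the tuple obtained from `a` by lowering the `i`-th entry
by `j`; it is `0` if `a i < j`. -/
noncomputable def loweredMultinomial {r : ℕ} (a : Fin r → ℕ) (i : Fin r) (j : ℕ) : ℝ :=
  ((∑ l, a l) - j).factorial * (a i).descFactorial j / ∏ l, ((a l).factorial : ℝ)

/-- The closed form of `M_r` at the tuple `a + 2`, valid when all entries of `a` are at
most `m`. -/
noncomputable def closedForm (m : ℕ) {r : ℕ} (a : Fin r → ℕ) : ℝ :=
  2 * ((∑ l, a l).factorial / ∏ l, ((a l).factorial : ℝ)) +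
    ∑ i, ∑ j ∈ Icc 1 m, loweredMultinomial a i j

lemma loweredMultinomial_zero {r : ℕ} (a : Fin r → ℕ) (i : Fin r) :
    loweredMultinomial a i 0 = (∑ l, a l).factorial / ∏ l, ((a l).factorial : ℝ) := by
  simp [loweredMultinomial]

lemma sum_update_pred {r : ℕ} (a : Fin r → ℕ) (l : Fin r) (hl : 1 ≤ a l) :
    ∑ x, Function.update a l (a l - 1) x = (∑ x, a x) - 1 := by
  rw [sum_update_of_mem (mem_univ l), ← add_sum_erase univ a (mem_univ l),
    sdiff_singleton_eq_erase]
  omega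

lemma prod_factorial_update_pred {r : ℕ} (a : Fin r → ℕ) (l : Fin r) (hl : 1 ≤ a l) :
    ∏ x, ((a x).factorial : ℝ) =
      a l * ∏ x, ((Function.update a l (a l - 1) x).factorial : ℝ) := by
  rw [← mul_prod_erase univ _ (mem_univ l), ← mul_prod_erase univ (fun x ↦
    ((Function.update a l (a l - 1) x).factorial : ℝ)) (mem_univ l), ← mul_assoc]
  congr 1
  · rw [Function.update_self, ← Nat.mul_factorial_pred (by omega)]
    push_cast
    rfl
  · refine prod_congr rfl fun x hx ↦ ?_
    rw [Function.update_of_ne (ne_of_mem_erase hx)]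

lemma mul_descFactorial_pred (n j : ℕ) (hn : 1 ≤ n) :
    (n : ℝ) * (n - 1).descFactorial j = n.descFactorial j * (n - j) := by
  obtain ⟨n, rfl⟩ := Nat.exists_eq_add_of_le' hn
  have h : (n + 1) * n.descFactorial j = (n + 1 - j) * (n + 1).descFactorial j := by
    rw [← Nat.succ_descFactorial_succ, Nat.descFactorial_succ]
  rcases le_or_gt j (n + 1) with hj | hj
  · have h' := congrArg (Nat.cast (R := ℝ)) h
    push_cast [Nat.cast_sub hj] at h'
    simp only [Nat.add_sub_cancel]
    push_cast
    linarith
  · simp [Nat.descFactorial_of_lt hj, Nat.descFactorial_of_lt (show n < j by omega)]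

lemma lt_sum_of_pos {r : ℕ} (hr : 2 ≤ r) (a : Fin r → ℕ) (ha : ∀ i, 1 ≤ a i) (i : Fin r) :
    a i < ∑ l, a l := by
  have : Nontrivial (Fin r) := Fin.nontrivial_iff_two_le.2 hr
  obtain ⟨l, hl⟩ := exists_ne i
  exact single_lt_sum hl (mem_univ i) (mem_univ l) (ha l) (fun _ _ _ ↦ Nat.zero_le _)

lemma loweredMultinomial_eq_sum {r : ℕ} (hr : 2 ≤ r) (a : Fin r → ℕ) (ha : ∀ i, 1 ≤ a i)
    (i : Fin r) (j : ℕ) :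
    loweredMultinomial a i j =
      ∑ l, loweredMultinomial (Function.update a l (a l - 1)) i j := by
  rcases lt_or_ge (a i) j with hj | hj
  · have h0 : ∀ l, Function.update a l (a l - 1) i < j := fun l ↦ by
      by_cases h : i = l
      · subst h; simp; omega
      · simpa [Function.update_of_ne h] using hj
    simp [loweredMultinomial, Nat.descFactorial_of_lt hj, Nat.descFactorial_of_lt (h0 _)]
  have hS := lt_sum_of_pos hr a ha i
  have hterm : ∀ l, loweredMultinomial (Function.update a l (a l - 1)) i j =
      ((∑ x, a x) - 1 - j).factorial * (a i).descFactorial j / (∏ x, ((a x).factorial : ℝ)) *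
        ((a l : ℝ) - if l = i then (j : ℝ) else 0) := by
    intro l
    have hl : (a l : ℝ) ≠ 0 := by have := ha l; positivity
    have hp : ∏ x, ((Function.update a l (a l - 1) x).factorial : ℝ) ≠ 0 :=
      prod_ne_zero_iff.2 fun x _ ↦ by positivity
    rw [loweredMultinomial, sum_update_pred a l (ha l), prod_factorial_update_pred a l (ha l)]
    by_cases h : l = i
    · subst h
      have hd := mul_descFactorial_pred (a l) j (ha l)
      rw [if_pos rfl]
      field_simp
      rw [Function.update_self]
      linear_combination hd
    · rw [if_neg h, Function.update_of_ne (Ne.symm h)]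
      field_simp
      ring
  have hfac : (((∑ x, a x) - j).factorial : ℝ) =
      ((∑ x, (a x : ℝ)) - j) * ((∑ x, a x) - 1 - j).factorial := by
    rw [← Nat.mul_factorial_pred (show (∑ x, a x) - j ≠ 0 by omega), Nat.sub_right_comm]
    push_cast [Nat.cast_sub (show j ≤ ∑ x, a x by omega)]
    rfl
  simp_rw [hterm]
  rw [← mul_sum, sum_sub_distrib, sum_ite_eq' univ i, if_pos (mem_univ i), loweredMultinomial,
    hfac]
  ring

lemma closedForm_eq_sum (m : ℕ) {r : ℕ} (hr : 2 ≤ r) (a : Fin r → ℕ) (ha : ∀ i, 1 ≤ a i) :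
    closedForm m a = ∑ l, closedForm m (Function.update a l (a l - 1)) := by
  have i₀ : Fin r := ⟨0, by omega⟩
  simp only [closedForm, ← loweredMultinomial_zero _ i₀]
  rw [sum_add_distrib, ← mul_sum, ← loweredMultinomial_eq_sum hr a ha]
  congr 1
  conv_rhs => rw [sum_comm]
  refine sum_congr rfl fun i _ ↦ ?_
  conv_rhs => rw [sum_comm]
  exact sum_congr rfl fun j _ ↦ loweredMultinomial_eq_sum hr a ha i j

lemma closedForm_succAbove (m : ℕ) {r : ℕ} (a : Fin (r + 1) → ℕ) (i : Fin (r + 1))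
    (hi : a i = 0) : closedForm m a = closedForm m (a ∘ i.succAbove) := by
  have hz : ∑ j ∈ Icc 1 m, loweredMultinomial a i j = 0 := sum_eq_zero fun j hj ↦ by
    have := (mem_Icc.1 hj).1
    simp [loweredMultinomial, Nat.descFactorial_of_lt (show a i < j by omega)]
  have hs : ∑ l, a l = ∑ l, a (i.succAbove l) := by
    rw [Fin.sum_univ_succAbove a i, hi, zero_add]
  have hp : ∏ l, ((a l).factorial : ℝ) = ∏ l, ((a (i.succAbove l)).factorial : ℝ) := by
    rw [Fin.prod_univ_succAbove (fun l ↦ ((a l).factorial : ℝ)) i, hi, Nat.factorial_zero,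
      Nat.cast_one, one_mul]
  rw [closedForm, Fin.sum_univ_succAbove (fun l ↦ ∑ j ∈ Icc 1 m, loweredMultinomial a l j) i,
    hz, zero_add]
  simp only [closedForm, loweredMultinomial, hs, hp, Function.comp_apply]

lemma closedForm_singleton (m : ℕ) (a : Fin 1 → ℕ) (ha : a 0 ≤ m) :
    closedForm m a = a 0 + 2 := by
  have hj : ∀ j ∈ Icc 1 m, loweredMultinomial a 0 j = if j ∈ Icc 1 (a 0) then 1 else 0 := by
    intro j hj
    have := (mem_Icc.1 hj).1
    by_cases h : j ≤ a 0
    · rw [if_pos (mem_Icc.2 ⟨this, h⟩)]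
      simp only [loweredMultinomial, Fin.sum_univ_one, Fin.prod_univ_one]
      rw [← Nat.cast_mul, Nat.factorial_mul_descFactorial h, div_self (by positivity)]
    · rw [if_neg (fun h' ↦ h (mem_Icc.1 h').2)]
      simp [loweredMultinomial, Nat.descFactorial_of_lt (not_le.1 h)]
  have hP : ((a 0).factorial : ℝ) ≠ 0 := by positivity
  simp only [closedForm, Fin.sum_univ_one, Fin.prod_univ_one]
  rw [sum_congr rfl hj, ← sum_filter, filter_mem_eq_inter,
    inter_eq_right.2 (Icc_subset_Icc le_rfl ha), div_self hP]
  simp [add_comm]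

theorem MwProps.eq_closedForm {M w : ∀ r : ℕ, (Fin r → ℕ) → ℕ} (hMw : MwProps M w) (m : ℕ)
    {r : ℕ} (hr : 2 ≤ r) (a : Fin r → ℕ) (ha : ∀ i, a i ≤ m) :
    (M r (fun i ↦ a i + 2) : ℝ) = closedForm m a := by
  obtain ⟨h2, hdel, hrec⟩ := hMw
  induction hn : r + ∑ i, a i using Nat.strong_induction_on generalizing r with
  | _ n ih =>
  subst hn
  by_cases hpos : ∀ i, 1 ≤ a i
  · have hs := (lt_sum_of_pos hr a hpos ⟨0, by omega⟩)
    rw [(hrec r hr _ fun i ↦ by have := hpos i; omega).1, closedForm_eq_sum m hr a hpos]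
    push_cast
    refine sum_congr rfl fun i _ ↦ ?_
    have hu : Function.update (fun i ↦ a i + 2) i (a i + 1) =
        fun l ↦ Function.update a i (a i - 1) l + 2 := by
      funext l
      have := hpos i
      by_cases h : l = i
      · subst h; simp; omega
      · simp [h]
    rw [hu]
    refine ih _ ?_ hr _ (fun l ↦ ?_) rfl
    · rw [sum_update_pred a i (hpos i)]; omega
    · by_cases h : l = i
      · subst h; have := ha l; simp; omega
      · simpa [h] using ha l
  push Not at hpos
  obtain ⟨i, hi⟩ := hpos
  replace hi : a i = 0 := by omega
  rcases hr.eq_or_lt with rfl | hr'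
  · rw [(h2 _ fun i ↦ by omega).1, closedForm_succAbove m a i hi,
      closedForm_singleton m _ (ha _)]
    fin_cases i
    · simp at hi
      simp [hi]
    · simp at hi
      simp [hi, Nat.choose_succ_self_right]
      ring
  · obtain ⟨r, rfl⟩ := Nat.exists_eq_succ_of_ne_zero (show r ≠ 0 by omega)
    rw [(hdel r (by omega) _ (fun i ↦ by omega) i (by omega)).1, closedForm_succAbove m a i hi]
    refine ih _ ?_ (by omega) (a ∘ i.succAbove) (fun l ↦ ha _) rfl
    rw [Fin.sum_univ_succAbove a i, hi]
    simp

lemma tendsto_mul_factorial_sub_div (m j : ℕ) (hm : 1 ≤ m) (hj : 1 ≤ j) :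
    Tendsto (fun r : ℕ ↦ (r : ℝ) * ((r * m - j).factorial * m.descFactorial j) /
      (r * m).factorial) atTop (𝓝 (if j = 1 then 1 else 0)) := by
  split_ifs with h
  · subst h
    refine tendsto_const_nhds.congr' ?_
    filter_upwards [eventually_ge_atTop 1] with r hr
    have hrm : r * m ≠ 0 := by positivity
    rw [← Nat.mul_factorial_pred hrm, Nat.descFactorial_one]
    have : (r : ℝ) ≠ 0 := by positivity
    have : (m : ℝ) ≠ 0 := by positivity
    push_cast
    field_simp
  · have hlim : Tendsto (fun r : ℕ ↦ (m.descFactorial j : ℝ) / ((r : ℝ) - 1)) atTop (𝓝 0) :=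
      tendsto_const_nhds.div_atTop
        (tendsto_atTop_add_const_right _ (-1) tendsto_natCast_atTop_atTop)
    refine squeeze_zero' (Eventually.of_forall fun r ↦ by positivity) ?_ hlim
    filter_upwards [eventually_ge_atTop 2] with r hr
    have hrm : r ≤ r * m := Nat.le_mul_of_pos_right r hm
    obtain ⟨n, hn⟩ := Nat.exists_eq_add_of_le' (hr.trans hrm)
    have hle : ((r * m - j).factorial : ℝ) ≤ n.factorial := by
      exact_mod_cast Nat.factorial_le (by omega)
    have hr2 : (2 : ℝ) ≤ r := by exact_mod_cast hr
    have hrn : (r : ℝ) ≤ n + 2 := by exact_mod_cast hn ▸ hrm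
    rw [div_le_div_iff₀ (by positivity) (by linarith)]
    have hfac : ((r * m).factorial : ℝ) = (n + 2) * ((n + 1) * n.factorial) := by
      rw [hn, Nat.factorial_succ, Nat.factorial_succ]
      push_cast
      ring
    rw [hfac]
    calc (r : ℝ) * ((r * m - j).factorial * m.descFactorial j) * (r - 1)
        ≤ (n + 2) * (n.factorial * m.descFactorial j) * (n + 1) := by
          gcongr
          · linarith
          · linarith
      _ = m.descFactorial j * ((n + 2) * ((n + 1) * n.factorial)) := by ring

lemma closedForm_const_mul_div (m r : ℕ) :
    closedForm m (fun _ : Fin r ↦ m) * (m.factorial : ℝ) ^ r / (r * m).factorial =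
      2 + ∑ j ∈ Icc 1 m,
        (r : ℝ) * ((r * m - j).factorial * m.descFactorial j) / (r * m).factorial := by
  have h1 : ((r * m).factorial : ℝ) ≠ 0 := by positivity
  have h2 : (m.factorial : ℝ) ^ r ≠ 0 := by positivity
  simp only [closedForm, loweredMultinomial, sum_const, card_univ, Fintype.card_fin, prod_const,
    smul_eq_mul, nsmul_eq_mul]
  rw [← sum_div, ← sum_div, ← mul_sum]
  field_simp

theorem stmt_12 (M w : ∀ r : ℕ, (Fin r → ℕ) → ℕ) (hMw : MwProps M w)
    (k : ℕ) (hk : 3 ≤ k) :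
    Filter.Tendsto
      (fun r : ℕ =>
        (M r (fun _ => k) : ℝ) * ((k - 2).factorial : ℝ) ^ r / ((r * (k - 2)).factorial : ℝ))
      Filter.atTop (nhds 3) := by
  obtain ⟨m, rfl⟩ := Nat.exists_eq_add_of_le' (show 2 ≤ k by omega)
  have hlim := (tendsto_finsetSum (Icc 1 m) fun j hj ↦
    tendsto_mul_factorial_sub_div m j (by omega) (mem_Icc.1 hj).1).const_add (2 : ℝ)
  rw [sum_ite_eq' (Icc 1 m) 1, if_pos (mem_Icc.2 ⟨le_rfl, by omega⟩)] at hlim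
  norm_num at hlim
  refine hlim.congr' ?_
  filter_upwards [eventually_ge_atTop 2] with r hr
  rw [hMw.eq_closedForm m hr (fun _ ↦ m) fun _ ↦ le_rfl, Nat.add_sub_cancel,
    closedForm_const_mul_div]
end

section
/- For every integer r ≥ 2, the diagonal waste function satisfies w_r(3) = (3 − e_r) · r! − 1, where e_r = Σ_{n=0}^r 1/n!. -/
/-- Lowering one `3` to `2` and deleting it gives `w_{r+1}(3) = (r+1) w_r(3) + (r-1)`. -/
theorem MwProps.waste_three_succ {M w : ∀ r : ℕ, (Fin r → ℕ) → ℕ} (hMw : MwProps M w)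
    {r : ℕ} (hr : 2 ≤ r) :
    w (r + 1) (fun _ => 3) = (r + 1) * w r (fun _ => 3) + (r - 1) := by
  obtain ⟨-, hdel, hrec⟩ := hMw
  have hterm (i : Fin (r + 1)) :
      w (r + 1) (Function.update (fun _ => 3) i (3 - 1)) = w r (fun _ => 3) := by
    rw [(hdel r hr (Function.update (fun _ => 3) i (3 - 1)) ?_ i (by simp)).2]
    · congr 1
      funext j
      simp
    · intro j
      by_cases hj : j = i <;> simp [hj]
  rw [(hrec (r + 1) (by omega) (fun _ => 3) (fun _ => le_rfl)).2,
    Finset.sum_congr rfl fun i _ => hterm i]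
  simp

theorem stmt_13 (M w : ∀ r : ℕ, (Fin r → ℕ) → ℕ) (hMw : MwProps M w)
    (r : ℕ) (hr : 2 ≤ r) :
    (w r (fun _ => 3) : ℝ) =
      (3 - ∑ n ∈ Finset.range (r + 1), (1 : ℝ) / n.factorial) * r.factorial - 1 := by
  induction r, hr using Nat.le_induction with
  | base =>
    rw [(hMw.1 (fun _ => 3) (by simp)).2]
    norm_num [Finset.sum_range_succ, Nat.factorial]
  | succ r hr ih =>
    have hfact : (r.factorial : ℝ) ≠ 0 := by positivity
    have hsucc : (r : ℝ) + 1 ≠ 0 := by positivity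
    rw [hMw.waste_three_succ hr, Finset.sum_range_succ, Nat.factorial_succ]
    push_cast [Nat.cast_sub (by omega : 1 ≤ r)]
    rw [ih]
    field_simp
    ring
end

section
/- For each fixed integer k ≥ 4, the liminf as r → ∞ of w_r(k) · ((k−2)!)^r / (r(k−2))! is at least (3−e)/2; equivalently, w_r(k) ≥ ((3−e)/2) · (r(k−2))!/((k−2)!)^r · (1 − o(1)) as r → ∞. -/
/-- The elementary symmetric polynomial `e₃` of `m`, written via power sums. -/
noncomputable def esymmThree {r : ℕ} (m : Fin r → ℕ) : ℝ :=
  ((∑ i, (m i : ℝ)) ^ 3 - 3 * (∑ i, (m i : ℝ)) * (∑ i, (m i : ℝ) ^ 2)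
    + 2 * ∑ i, (m i : ℝ) ^ 3) / 6

/-- The number of lattice paths from `m` down to a `0-1` vector with exactly three ones. -/
noncomputable def pathsToTriples {r : ℕ} (m : Fin r → ℕ) : ℝ :=
  (((∑ i, m i) - 3).factorial : ℝ) / (∏ i, ((m i).factorial : ℝ)) * esymmThree m

theorem sum_comp_update {r : ℕ} (m : Fin r → ℕ) (i : Fin r) (v : ℕ) (φ : ℕ → ℝ) :
    ∑ j, φ (Function.update m i v j) = ∑ j, φ (m j) + φ v - φ (m i) := by
  have h : ∀ j, φ (Function.update m i v j) = φ (m j) + if j = i then φ v - φ (m i) else 0 := by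
    intro j
    by_cases hj : j = i
    · subst hj; simp
    · simp [hj]
  simp_rw [h, Finset.sum_add_distrib]
  simp
  ring

theorem prod_factorial_update {r : ℕ} (m : Fin r → ℕ) (i : Fin r) (hi : 1 ≤ m i) :
    ∏ j, ((m j).factorial : ℝ)
      = m i * ∏ j, ((Function.update m i (m i - 1) j).factorial : ℝ) := by
  rw [← Finset.mul_prod_erase _ _ (Finset.mem_univ i),
    ← Finset.mul_prod_erase _ (fun j => ((Function.update m i (m i - 1) j).factorial : ℝ))
      (Finset.mem_univ i), ← mul_assoc]
  congr 1
  · rw [Function.update_self]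
    exact_mod_cast (Nat.mul_factorial_pred (by omega)).symm
  · refine Finset.prod_congr rfl fun j hj => ?_
    rw [Function.update_of_ne (Finset.ne_of_mem_erase hj)]

theorem sum_mul_esymmThree_update {r : ℕ} (m : Fin r → ℕ) (hm : ∀ i, 1 ≤ m i) :
    ∑ i, (m i : ℝ) * esymmThree (Function.update m i (m i - 1))
      = ((∑ i, (m i : ℝ)) - 3) * esymmThree m := by
  set n := ∑ i, (m i : ℝ) with hn
  set q := ∑ i, (m i : ℝ) ^ 2 with hq
  set c := ∑ i, (m i : ℝ) ^ 3 with hc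
  have key : ∀ i, (m i : ℝ) * esymmThree (Function.update m i (m i - 1))
      = (((n - 1) ^ 3 - 3 * (n - 1) * (q + 1) + 2 * (c - 1)) / 6) * (m i : ℝ)
        + n * (m i : ℝ) ^ 2 - (m i : ℝ) ^ 3 := by
    intro i
    have h1 := sum_comp_update m i (m i - 1) (fun x => (x : ℝ))
    have h2 := sum_comp_update m i (m i - 1) (fun x => (x : ℝ) ^ 2)
    have h3 := sum_comp_update m i (m i - 1) (fun x => (x : ℝ) ^ 3)
    simp only [Nat.cast_sub (hm i), Nat.cast_one] at h1 h2 h3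
    rw [esymmThree, h1, h2, h3, ← hn, ← hq, ← hc]
    ring
  simp_rw [key]
  rw [Finset.sum_sub_distrib, Finset.sum_add_distrib, ← Finset.mul_sum, ← Finset.mul_sum,
    ← hn, ← hq, ← hc, esymmThree, ← hn, ← hq, ← hc]
  ring

theorem pathsToTriples_eq_sum {r : ℕ} (m : Fin r → ℕ) (hm : ∀ i, 1 ≤ m i)
    (hn : 4 ≤ ∑ i, m i) :
    pathsToTriples m = ∑ i, pathsToTriples (Function.update m i (m i - 1)) := by
  have key : ∀ i, pathsToTriples (Function.update m i (m i - 1))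
      = ((((∑ i, m i) - 4).factorial : ℝ) / (∏ j, ((m j).factorial : ℝ)))
        * ((m i : ℝ) * esymmThree (Function.update m i (m i - 1))) := by
    intro i
    have hs : ∑ j, Function.update m i (m i - 1) j = (∑ j, m j) - 1 := by
      have h1 := sum_comp_update m i (m i - 1) (fun x => (x : ℝ))
      simp only [Nat.cast_sub (hm i), Nat.cast_one] at h1
      have h2 : ((∑ j, Function.update m i (m i - 1) j : ℕ) : ℝ) + 1 = ((∑ j, m j : ℕ) : ℝ) := by
        push_cast
        rw [h1]
        ring
      have h3 : (∑ j, Function.update m i (m i - 1) j) + 1 = ∑ j, m j := by exact_mod_cast h2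
      omega
    have hp := prod_factorial_update m i (hm i)
    have hmi : (m i : ℝ) ≠ 0 := by
      have := hm i
      positivity
    have hP' : (∏ j, ((Function.update m i (m i - 1) j).factorial : ℝ)) ≠ 0 :=
      Finset.prod_ne_zero_iff.2 fun j _ => by positivity
    rw [pathsToTriples, hs, hp, Nat.sub_sub]
    field_simp
  simp_rw [key]
  rw [← Finset.mul_sum, sum_mul_esymmThree_update m hm, pathsToTriples]
  have hf : (((∑ i, m i) - 3).factorial : ℝ)
      = ((∑ i, (m i : ℝ)) - 3) * (((∑ i, m i) - 4).factorial : ℝ) := by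
    obtain ⟨a, ha⟩ := Nat.exists_eq_add_of_le hn
    have hc : (∑ i, (m i : ℝ)) = ((∑ i, m i : ℕ) : ℝ) := by push_cast; rfl
    rw [hc, ha, show 4 + a - 3 = a + 1 by omega, show 4 + a - 4 = a by omega,
      Nat.factorial_succ]
    push_cast
    ring
  rw [hf]
  ring

theorem pathsToTriples_succAbove {r : ℕ} (m : Fin (r + 1) → ℕ) (i : Fin (r + 1)) (hi : m i = 0) :
    pathsToTriples m = pathsToTriples (m ∘ i.succAbove) := by
  simp [pathsToTriples, esymmThree, Fin.sum_univ_succAbove _ i, Fin.prod_univ_succAbove _ i, hi]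

theorem pathsToTriples_le {M w : ∀ r : ℕ, (Fin r → ℕ) → ℕ} (hMw : MwProps M w) (N : ℕ) :
    ∀ r, 2 ≤ r → ∀ m : Fin r → ℕ, r + ∑ i, m i = N →
      pathsToTriples m ≤ (w r (fun i => m i + 2) : ℝ) := by
  obtain ⟨-, hdrop, hrec⟩ := hMw
  induction N using Nat.strong_induction_on with
  | _ N ih =>
  intro r hr m hN
  obtain rfl | hr3 : r = 2 ∨ 3 ≤ r := by omega
  · have h0 : esymmThree m = 0 := by
      simp only [esymmThree, Fin.sum_univ_two]
      ring
    rw [pathsToTriples, h0, mul_zero]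
    positivity
  by_cases hz : ∃ i, m i = 0
  · obtain ⟨i, hi⟩ := hz
    obtain ⟨s, rfl⟩ : ∃ s, r = s + 1 := ⟨r - 1, by omega⟩
    rw [pathsToTriples_succAbove m i hi,
      (hdrop s (by omega) (fun j => m j + 2) (fun j => by omega) i (by simp [hi])).2]
    refine ih (s + ∑ j, (m ∘ i.succAbove) j) ?_ s (by omega) _ rfl
    rw [Fin.sum_univ_succAbove _ i, hi] at hN
    simp only [Function.comp]
    omega
  push Not at hz
  have hm : ∀ i, 1 ≤ m i := fun i => Nat.one_le_iff_ne_zero.2 (hz i)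
  have hrn : r ≤ ∑ i, m i := by
    simpa using Finset.sum_le_sum (fun i (_ : i ∈ Finset.univ) => hm i)
  rw [(hrec r hr (fun i => m i + 2) (fun i => by have := hm i; omega)).2]
  have hup : ∀ i, Function.update (fun j => m j + 2) i (m i + 2 - 1)
      = fun j => Function.update m i (m i - 1) j + 2 := by
    intro i
    ext j
    have := hm i
    by_cases hj : j = i
    · subst hj; simp; omega
    · simp [hj]
  simp_rw [hup]
  obtain h4 | h3 : 4 ≤ ∑ i, m i ∨ ∑ i, m i = 3 := by omega
  · rw [pathsToTriples_eq_sum m hm h4]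
    push_cast
    refine le_add_of_le_of_nonneg (Finset.sum_le_sum fun i _ => ?_) (by positivity)
    refine ih (r + ∑ j, Function.update m i (m i - 1) j) ?_ r hr _ rfl
    rw [← hN]
    refine Nat.add_lt_add_left (Finset.sum_lt_sum (fun j _ => ?_) ⟨i, Finset.mem_univ i, ?_⟩) r
    · by_cases hj : j = i
      · subst hj; simp
      · simp [hj]
    · have := hm i
      simp; omega
  · obtain rfl : r = 3 := by omega
    rw [Fin.sum_univ_three] at h3
    have := hm 0
    have := hm 1
    have := hm 2
    have h0 : m 0 = 1 := by omega
    have h1 : m 1 = 1 := by omega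
    have h2 : m 2 = 1 := by omega
    have h : pathsToTriples m = 1 := by
      simp only [pathsToTriples, esymmThree, Fin.sum_univ_three, Fin.prod_univ_three, h0, h1, h2]
      norm_num
    rw [h]
    norm_cast
    omega

theorem pathsToTriples_const (r t : ℕ) :
    pathsToTriples (fun _ : Fin r => t)
      = ((r * t - 3).factorial : ℝ) / (t.factorial : ℝ) ^ r
        * ((t : ℝ) ^ 3 * (r * (r - 1) * (r - 2)) / 6) := by
  simp only [pathsToTriples, esymmThree, Finset.sum_const, Finset.prod_const, Finset.card_univ,
    Fintype.card_fin, nsmul_eq_mul, smul_eq_mul]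
  ring

theorem factorial_le_cube_mul {n : ℕ} (hn : 3 ≤ n) :
    (n.factorial : ℝ) ≤ (n : ℝ) ^ 3 * ((n - 3).factorial : ℝ) := by
  obtain ⟨a, rfl⟩ := Nat.exists_eq_add_of_le' hn
  rw [Nat.add_sub_cancel, Nat.factorial_succ, Nat.factorial_succ, Nat.factorial_succ]
  push_cast
  have ha : (0 : ℝ) ≤ a := a.cast_nonneg
  rw [← mul_assoc, ← mul_assoc]
  gcongr
  nlinarith [mul_nonneg ha ha]

theorem stmt_15 (M w : ∀ r : ℕ, (Fin r → ℕ) → ℕ) (hMw : MwProps M w)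
    (k : ℕ) (hk : 4 ≤ k) :
    ∀ ε : ℝ, 0 < ε → ∀ᶠ r : ℕ in Filter.atTop,
      ((3 - Real.exp 1) / 2 - ε) * ((r * (k - 2)).factorial : ℝ) / ((k - 2).factorial : ℝ) ^ r
        ≤ (w r (fun _ => k) : ℝ) := by
  intro ε hε
  filter_upwards [Filter.eventually_ge_atTop 30] with r hr
  obtain ⟨t, rfl⟩ : ∃ t, k = t + 2 := ⟨k - 2, by omega⟩
  rw [Nat.add_sub_cancel]
  refine le_trans ?_ (pathsToTriples_le hMw _ r (by omega) (fun _ => t) rfl)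
  rw [pathsToTriples_const, div_mul_eq_mul_div]
  refine div_le_div_of_nonneg_right ?_ (by positivity)
  have hn : 3 ≤ r * t := by nlinarith
  have hfac := factorial_le_cube_mul hn
  have hcoef : (3 - Real.exp 1) / 2 - ε ≤ 3 / 20 := by
    linarith [Real.exp_one_gt_d9]
  have hr' : (30 : ℝ) ≤ r := by exact_mod_cast hr
  have hpoly : 3 / 20 * (r : ℝ) ^ 3 ≤ r * (r - 1) * (r - 2) / 6 := by
    nlinarith [mul_nonneg (sq_nonneg (r : ℝ)) (sub_nonneg.2 hr')]
  calc ((3 - Real.exp 1) / 2 - ε) * ((r * t).factorial : ℝ)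
      ≤ 3 / 20 * (((r * t : ℕ) : ℝ) ^ 3 * ((r * t - 3).factorial : ℝ)) := by gcongr
    _ = ((r * t - 3).factorial : ℝ) * ((t : ℝ) ^ 3 * (3 / 20 * (r : ℝ) ^ 3)) := by
        push_cast; ring
    _ ≤ ((r * t - 3).factorial : ℝ) * ((t : ℝ) ^ 3 * (r * (r - 1) * (r - 2) / 6)) := by gcongr
    _ = _ := by ring
end
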